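/- Let k be a finitely generated field of characteristic zero; let R be a finitely generated k-algebra that is an integral domain with k relatively algebraically closed in Frac(R); let S be a finitely generated k-algebra such that k is relatively algebraically closed in Frac(S/P) for every minimal prime ideal P of S; and let f₁, f₂ : R → S be k-algebra homomorphisms that take nonzero elements of R to regular elements (non zero-divisors) of S, so that f₁, f₂ extend uniquely to embeddings of Frac(R) into the total ring of fractions Frac(S). Suppose there exists a sequence of nonzero elements (a_j : j < ω) in R that is multiplicatively independent modulo k^×, and such that f₁(a_j)S = f₂(a_j)S for all j < ω. Then there exists g ∈ Frac(R) \ k such that f₁(g) = f₂(g). In fact, if F is the subfield of Frac(R) on which f₁ and f₂ agree and G is the subgroup of Frac(R)^× generated by the a_j, then G ∩ F is nontrivial. -/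

import Mathlib

/-!
# Theorem 3.1: the principal algebraic statement

`k` is a finitely generated field of characteristic zero, `R` a finitely generated
`k`-algebra domain with `k` relatively algebraically closed in `Frac(R)`, and `S` a
finitely generated `k`-algebra with `k` relatively algebraically closed in `Frac(S/P)` for
every minimal prime `P` of `S`.  The fraction field of `R` is modelled by an abstract
fraction field `FR`, and the total ring of fractions of `S` (localisation at the regular
elements) by `FS`.  The `k`-algebra maps `f₁, f₂ : R → S` send nonzero elements to regular
elements, hence extend uniquely to embeddings `F₁, F₂ : Frac(R) → Frac(S)` (quantified with
their characterising property).

For the quotient domains `S/P`, relative algebraic closedness of `k` in `Frac(S/P)` is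
expressed denominator-freely via `IsFracAlgebraic`.
-/

/-- The fraction `a/b` of elements of the `k`-algebra `D` (an element of the fraction field
when `D` is a domain and `b ≠ 0`) is algebraic over `k`: a homogenised nonzero polynomial
relation with coefficients in `k` holds. -/
def IsFracAlgebraic (k : Type*) [CommRing k] {D : Type*} [CommRing D] [Algebra k D]
    (a b : D) : Prop :=
  ∃ p : Polynomial k, p ≠ 0 ∧
    ∑ i ∈ Finset.range (p.natDegree + 1),
      algebraMap k D (p.coeff i) * a ^ i * b ^ (p.natDegree - i) = 0

/-- The subgroup `H'` has finite corank relative to `H`: the abelian group `H / (H ⊓ H')` has finite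
rank, i.e. any sufficiently long finite sequence in `H` has a nontrivial multiplicative relation
modulo `H'`. -/
def RelFiniteRank {Γ : Type*} [CommGroup Γ] (H H' : Subgroup Γ) : Prop :=
  ∃ n : ℕ, ∀ v : Fin n → Γ, (∀ i, v i ∈ H) → ∃ c : Fin n → ℤ, c ≠ 0 ∧ ∏ i, v i ^ c i ∈ H'

theorem Finset.zpow_sum_eq_prod {ι X : Type*} [CommGroup X] (s : Finset ι) (x : X) (c : ι → ℤ) :
    x ^ ∑ i ∈ s, c i = ∏ i ∈ s, x ^ c i := by
  classical
  induction s using Finset.induction_on with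
  | empty => simp
  | insert a s ha ih => rw [Finset.sum_insert ha, Finset.prod_insert ha, zpow_add, ih]

namespace RelFiniteRank

variable {Γ : Type*} [CommGroup Γ] {H H' H'' : Subgroup Γ}

theorem of_fintype {ι : Type*} [Fintype ι]
    (h : ∀ v : ι → Γ, (∀ i, v i ∈ H) → ∃ c : ι → ℤ, c ≠ 0 ∧ ∏ i, v i ^ c i ∈ H') :
    RelFiniteRank H H' := by
  classical
  refine ⟨Fintype.card ι, fun v hv => ?_⟩
  let e := Fintype.equivFin ι
  obtain ⟨c, hc, hcm⟩ := h (v ∘ e) (fun i => hv _)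
  refine ⟨c ∘ e.symm, fun h0 => hc ?_, ?_⟩
  · funext i
    simpa using congrFun h0 (e i)
  · rw [← Equiv.prod_comp e]
    simpa using hcm

theorem mono (h : RelFiniteRank H H') (hle : H' ≤ H'') : RelFiniteRank H H'' := by
  obtain ⟨n, hn⟩ := h
  refine ⟨n, fun v hv => ?_⟩
  obtain ⟨c, hc, hcm⟩ := hn v hv
  exact ⟨c, hc, hle hcm⟩

theorem anti (h : RelFiniteRank H H'') (hle : H' ≤ H) : RelFiniteRank H' H'' := by
  obtain ⟨n, hn⟩ := h
  exact ⟨n, fun v hv => hn v fun i => hle (hv i)⟩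

theorem trans (h : RelFiniteRank H H') (h' : RelFiniteRank H' H'') : RelFiniteRank H H'' := by
  obtain ⟨n, hn⟩ := h
  obtain ⟨m, hm⟩ := h'
  refine of_fintype (ι := Fin m × Fin n) fun v hv => ?_
  choose c hc hcm using fun i : Fin m => hn (fun j => v (i, j)) (fun j => hv _)
  obtain ⟨d, hd, hdm⟩ := hm (fun i => ∏ j, v (i, j) ^ c i j) hcm
  refine ⟨fun p => c p.1 p.2 * d p.1, fun h0 => ?_, ?_⟩
  · obtain ⟨i, hi⟩ := Function.ne_iff.1 hd
    obtain ⟨j, hj⟩ := Function.ne_iff.1 (hc i)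
    exact mul_ne_zero hj hi (congrFun h0 (i, j))
  · rw [Fintype.prod_prod_type]
    convert hdm using 2 with i
    rw [← Finset.prod_zpow]
    exact Finset.prod_congr rfl fun j _ => zpow_mul _ _ _

theorem inf_right (h : RelFiniteRank H H') : RelFiniteRank H (H ⊓ H') := by
  obtain ⟨n, hn⟩ := h
  refine ⟨n, fun v hv => ?_⟩
  obtain ⟨c, hc, hcm⟩ := hn v hv
  exact ⟨c, hc, Subgroup.prod_mem _ fun i _ => Subgroup.zpow_mem _ (hv i) _, hcm⟩

theorem inf (h : RelFiniteRank H H') (h' : RelFiniteRank H H'') :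
    RelFiniteRank H (H' ⊓ H'') :=
  h.inf_right.trans (((h'.anti inf_le_left).inf_right).mono (by
    rw [inf_assoc]; exact inf_le_right))

theorem refl (H : Subgroup Γ) : RelFiniteRank H H :=
  ⟨1, fun _ hv => ⟨1, one_ne_zero, Subgroup.prod_mem _ fun i _ => Subgroup.zpow_mem _ (hv i) _⟩⟩

theorem finset_inf {ι : Type*} (s : Finset ι) (K : ι → Subgroup Γ)
    (h : ∀ i ∈ s, RelFiniteRank H (K i)) : RelFiniteRank H (s.inf K) := by
  classical
  induction s using Finset.induction_on with
  | empty => exact (refl H).mono le_top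
  | insert a s ha ih =>
    rw [Finset.inf_insert]
    exact (h a (Finset.mem_insert_self _ _)).inf
      (ih fun i hi => h i (Finset.mem_insert_of_mem hi))

/-- If all elements of `φ H` lie in the subgroup generated by `W` and finitely many elements, then
`φ⁻¹ W` has finite corank relative to `H`. -/
theorem of_generators {X : Type*} [CommGroup X] (φ : Γ →* X) (W : Subgroup X) {r : ℕ}
    (b : Fin r → X)
    (hb : ∀ g ∈ H, ∃ e : Fin r → ℤ, ∃ w ∈ W, φ g = w * ∏ i, b i ^ e i) :
    RelFiniteRank H (W.comap φ) := by
  refine ⟨r + 1, fun v hv => ?_⟩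
  choose e w hw he using fun i => hb (v i) (hv i)
  have hdep : ¬ LinearIndependent ℤ e := fun h => by
    have := h.fintype_card_le_finrank
    simp at this
  obtain ⟨c, hc, i, hi⟩ := Fintype.not_linearIndependent_iff.1 hdep
  refine ⟨c, fun h0 => hi (congrFun h0 i), ?_⟩
  rw [Subgroup.mem_comap, map_prod]
  have : ∏ j, φ (v j ^ c j) = ∏ j, w j ^ c j := by
    have h1 : ∀ j, φ (v j ^ c j) = w j ^ c j * ∏ i, b i ^ (c j * e j i) := fun j => by
      rw [map_zpow, he, mul_zpow, ← Finset.prod_zpow]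
      simp only [← zpow_mul, mul_comm]
    simp only [h1, Finset.prod_mul_distrib]
    rw [Finset.prod_comm]
    have h2 : ∀ i, ∏ j, b i ^ (c j * e j i) = 1 := fun i => by
      have := congrFun hc i
      simp only [Finset.sum_apply, Pi.smul_apply, smul_eq_mul, Pi.zero_apply] at this
      rw [← Finset.zpow_sum_eq_prod, this, zpow_zero]
    simp [h2]
  rw [this]
  exact Subgroup.prod_mem _ fun i _ => Subgroup.zpow_mem _ (hw i) _

end RelFiniteRank

section

open scoped WithZero

theorem Valuation.isPrincipalIdealRing_valuationSubring {K : Type*} [Field K]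
    (v : Valuation K ℤᵐ⁰) : IsPrincipalIdealRing v.valuationSubring := by
  by_cases h : Nontrivial (MonoidWithZeroHom.valueGroup (.ofClass v))
  · exact Valuation.valuationSubring_isPrincipalIdealRing v
  · rw [not_nontrivial_iff_subsingleton] at h
    have hv : ∀ z : K, z ≠ 0 → v z = 1 := fun z hz => by
      have hz' : v z ≠ 0 := (Valuation.ne_zero_iff v).2 hz
      have h1 : Units.mk0 (v z) hz' ∈ MonoidWithZeroHom.valueGroup (.ofClass v) := by
        apply MonoidWithZeroHom.mem_valueGroup
        exact ⟨z, rfl⟩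
      have h2 := congrArg Subtype.val
        (h.elim ⟨_, h1⟩ (1 : MonoidWithZeroHom.valueGroup (.ofClass v)))
      simpa using congrArg Units.val h2
    have hF : IsField v.valuationSubring := by
      refine ⟨⟨0, 1, zero_ne_one⟩, mul_comm, fun {a} ha => ?_⟩
      have ha' : (a : K) ≠ 0 := fun h => ha (Subtype.ext h)
      exact ⟨⟨(a : K)⁻¹, by
        rw [Valuation.mem_valuationSubring_iff, hv _ (inv_ne_zero ha')]⟩,
        Subtype.ext (mul_inv_cancel₀ ha')⟩
    let := hF.toField
    infer_instance

/-- The valuation `p ↦ exp (totalDegree p)` on a polynomial ring over a field. -/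
noncomputable def MvPolynomial.totalDegreeValuation (σ k : Type*) [Field k] :
    Valuation (MvPolynomial σ k) ℤᵐ⁰ := by
  classical
  exact
  { toFun := fun p => if p = 0 then 0 else WithZero.exp (p.totalDegree : ℤ)
    map_zero' := if_pos rfl
    map_one' := by simp
    map_mul' := fun p q => by
      by_cases hp : p = 0
      · simp [hp]
      by_cases hq : q = 0
      · simp [hq]
      simp [hp, hq, MvPolynomial.totalDegree_mul_of_isDomain hp hq, WithZero.exp_add]
    map_add_le_max' := fun p q => by
      by_cases hp : p = 0
      · simp [hp]
      by_cases hq : q = 0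
      · simp [hq]
      by_cases hpq : p + q = 0
      · simp [hpq]
      have := MvPolynomial.totalDegree_add p q
      simp only [hp, hq, hpq, if_false, le_max_iff, WithZero.exp_le_exp, Nat.cast_le]
      exact le_max_iff.1 this }

theorem MvPolynomial.totalDegreeValuation_of_ne_zero {σ k : Type*} [Field k]
    {p : MvPolynomial σ k} (hp : p ≠ 0) :
    totalDegreeValuation σ k p = WithZero.exp (p.totalDegree : ℤ) := by
  classical
  exact if_neg hp

theorem MvPolynomial.totalDegreeValuation_eq_zero {σ k : Type*} [Field k]
    {p : MvPolynomial σ k} : totalDegreeValuation σ k p = 0 ↔ p = 0 := by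
  refine ⟨fun h => ?_, fun h => by rw [h, map_zero]⟩
  by_contra hp
  rw [totalDegreeValuation_of_ne_zero hp] at h
  exact WithZero.exp_ne_zero h

theorem MvPolynomial.finiteDimensional_restrictTotalDegree {σ k : Type*} [Finite σ] [Field k]
    (n : ℕ) : FiniteDimensional k (restrictTotalDegree σ k n) := by
  have : Finite {s : σ →₀ ℕ | (s.sum fun _ e => e) ≤ n} := by
    cases nonempty_fintype σ
    have := Finsupp.finite_of_degree_le (σ := σ) n
    refine (this.subset fun s hs => ?_)
    exact hs
  unfold restrictTotalDegree
  exact Module.Finite.of_basis (basisRestrictSupport k _)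

theorem integralClosure.exists_finite_generators_units (O K L : Type*) [CommRing O] [IsDomain O]
    [IsPrincipalIdealRing O] [IsLocalRing O] [Field K] [Field L] [Algebra O K] [IsFractionRing O K]
    [Algebra K L] [Algebra O L] [IsScalarTower O K L] [FiniteDimensional K L]
    [Algebra.IsSeparable K L] :
    ∃ r : ℕ, ∃ b : Fin r → Lˣ, ∀ z : Lˣ, ∃ e : Fin r → ℤ, ∃ w : Lˣ,
      (w : L) ∈ integralClosure O L ∧ ((w⁻¹ : Lˣ) : L) ∈ integralClosure O L ∧
      z = w * ∏ i, b i ^ e i := by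
  classical
  set B := integralClosure O L with hB
  have : IsDedekindDomain B := integralClosure.isDedekindDomain O K L
  have : IsFractionRing B L := integralClosure.isFractionRing_of_finite_extension K L
  have hinj : Function.Injective (algebraMap O L) := by
    rw [IsScalarTower.algebraMap_eq O K L]
    exact (algebraMap K L).injective.comp (IsFractionRing.injective O K)
  have : FaithfulSMul O L := (faithfulSMul_iff_algebraMap_injective O L).2 hinj
  have hfinp : {I : Ideal B | I.IsPrime}.Finite := by
    have h1 : {I : Ideal B | I.IsPrime} ⊆
        {⊥} ∪ Ideal.primesOver (IsLocalRing.maximalIdeal O) B := by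
      intro I hI
      by_cases h : I = ⊥
      · exact Or.inl h
      · right
        have hIp : I.IsPrime := hI
        have : I.IsMaximal := hIp.isMaximal h
        have hm : (I.comap (algebraMap O B)).IsMaximal :=
          Ideal.isMaximal_comap_of_isIntegral_of_isMaximal I
        exact ⟨hIp, ⟨(IsLocalRing.eq_maximalIdeal hm).symm⟩⟩
    exact ((Set.finite_singleton _).union
      (IsDedekindDomain.primesOver_finite (IsLocalRing.maximalIdeal O) B)).subset h1
  have : IsPrincipalIdealRing B := IsPrincipalIdealRing.of_finite_primes hfinp
  let T : Set (Ideal B) := {I | I.IsPrime ∧ I ≠ ⊥}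
  have hT : T.Finite := hfinp.subset fun I hI => hI.1
  have : Fintype T := hT.fintype
  have hgen : ∀ I : T, ∃ x : B, x ≠ 0 ∧ I.1 = Ideal.span {x} := fun I => by
    obtain ⟨x, hx⟩ := (IsPrincipalIdealRing.principal I.1)
    refine ⟨x, fun h0 => I.2.2 ?_, hx⟩
    rw [hx, h0]; simp
  choose x hx0 hx using hgen
  have hx0' : ∀ I, algebraMap B L (x I) ≠ 0 := fun I => by
    simpa using hx0 I
  let b' : T → Lˣ := fun I => Units.mk0 _ (hx0' I)
  let W : Subgroup Lˣ := (Units.map (algebraMap B L : B →* L)).range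
  let G : Subgroup Lˣ :=
    { carrier := {z | ∃ e : T → ℤ, ∃ w ∈ W, z = w * ∏ i, b' i ^ e i}
      one_mem' := ⟨0, 1, W.one_mem, by simp⟩
      mul_mem' := by
        rintro _ _ ⟨e, w, hw, rfl⟩ ⟨e', w', hw', rfl⟩
        refine ⟨e + e', w * w', W.mul_mem hw hw', ?_⟩
        simp only [Pi.add_apply, zpow_add, Finset.prod_mul_distrib]
        rw [mul_mul_mul_comm]
      inv_mem' := by
        rintro _ ⟨e, w, hw, rfl⟩
        refine ⟨-e, w⁻¹, W.inv_mem hw, ?_⟩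
        simp [mul_comm] }
  have hBG : ∀ c : B, ∀ hc : c ≠ 0, Units.mk0 (algebraMap B L c) (by simpa using hc) ∈ G := by
    intro c
    induction c using WfDvdMonoid.induction_on_irreducible with
    | zero => intro hc; exact absurd rfl hc
    | unit u hu =>
      intro hc
      obtain ⟨u, rfl⟩ := hu
      exact ⟨0, _, ⟨u, rfl⟩, by ext; simp⟩
    | mul a i ha hi ih =>
      intro hc
      have hIT : Ideal.span {i} ∈ T :=
        ⟨(Ideal.span_singleton_prime hi.ne_zero).2 hi.prime, by simpa using hi.ne_zero⟩
      obtain ⟨u, hu⟩ := Ideal.span_singleton_eq_span_singleton.1 (hx ⟨_, hIT⟩)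
      have h1 : Units.mk0 (algebraMap B L i) (by simpa using hi.ne_zero) ∈ G := by
        refine ⟨Pi.single ⟨_, hIT⟩ 1, (Units.map (algebraMap B L : B →* L) u)⁻¹,
          W.inv_mem ⟨u, rfl⟩, ?_⟩
        have h2 : ∏ j, b' j ^ (Pi.single ⟨_, hIT⟩ 1 : T → ℤ) j = b' ⟨_, hIT⟩ := by
          rw [Finset.prod_eq_single ⟨_, hIT⟩]
          · simp
          · intro j _ hj; simp [hj]
          · simp
        rw [h2, eq_inv_mul_iff_mul_eq]
        ext
        simp only [Units.val_mul, Units.val_mk0, b']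
        rw [← hu, map_mul, mul_comm]
        rfl
      have := G.mul_mem h1 (ih ha)
      convert! this using 1
      ext; simp
  have hG : ∀ z : Lˣ, z ∈ G := by
    intro z
    obtain ⟨c, d, hd, hz⟩ := IsFractionRing.div_surjective (A := B) (z : L)
    have hd0 := nonZeroDivisors.ne_zero hd
    have hc0 : c ≠ 0 := by
      rintro rfl
      exact z.ne_zero (by rw [← hz]; simp)
    have := G.mul_mem (hBG c hc0) (G.inv_mem (hBG d hd0))
    convert! this using 1
    ext
    simp [← hz, div_eq_mul_inv]
  refine ⟨Fintype.card T, fun i => b' ((Fintype.equivFin T).symm i), fun z => ?_⟩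
  obtain ⟨e, w, ⟨u, rfl⟩, hz⟩ := hG z
  refine ⟨fun i => e ((Fintype.equivFin T).symm i), Units.map (algebraMap B L : B →* L) u,
    (u : B).2, ((u⁻¹ : Bˣ) : B).2, ?_⟩
  rw [hz, ← Equiv.prod_comp (Fintype.equivFin T).symm]

end

section

open scoped nonZeroDivisors

theorem MvPolynomial.totalDegree_pderiv_le {σ k : Type*} [CommSemiring k] (i : σ)
    (p : MvPolynomial σ k) : (pderiv i p).totalDegree ≤ p.totalDegree := by
  refine Finset.sup_le fun m hm => ?_
  have hm' : m + Finsupp.single i 1 ∈ p.support := by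
    rw [mem_support_iff, coeff_pderiv] at hm
    exact mem_support_iff.2 (left_ne_zero_of_mul hm)
  refine le_trans ?_ (le_totalDegree hm')
  rw [Finsupp.sum_add_index' (fun _ => rfl) (fun _ _ _ => rfl)]
  exact Nat.le_add_right _ _

theorem Derivation.apply_algebraMap_mvPolynomial {k κ σ : Type*} [Field k] [Fintype σ] [Field κ]
    [Algebra k κ] [Algebra (MvPolynomial σ k) κ] [IsScalarTower k (MvPolynomial σ k) κ]
    (D : Derivation k κ κ) (p : MvPolynomial σ k) :
    D (algebraMap _ κ p) = ∑ i, algebraMap _ κ (MvPolynomial.pderiv i p) *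
      D (algebraMap (MvPolynomial σ k) κ (MvPolynomial.X i)) := by
  classical
  let D₂ : Derivation k (MvPolynomial σ k) κ :=
    ∑ i, (D (algebraMap (MvPolynomial σ k) κ (MvPolynomial.X i))) •
      (((Algebra.linearMap (MvPolynomial σ k) κ).compDer (MvPolynomial.pderiv i)))
  have hD₂ : ∀ p, D₂ p = ∑ i, algebraMap _ κ (MvPolynomial.pderiv i p) *
      D (algebraMap (MvPolynomial σ k) κ (MvPolynomial.X i)) := fun p => by
    have := congrFun (map_sum Derivation.coeFnAddMonoidHom
      (fun i => (D (algebraMap (MvPolynomial σ k) κ (MvPolynomial.X i))) •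
      (((Algebra.linearMap (MvPolynomial σ k) κ).compDer (MvPolynomial.pderiv i)))) Finset.univ) p
    simp only [Derivation.coeFnAddMonoidHom_apply, Finset.sum_apply] at this
    refine this.trans (Finset.sum_congr rfl fun i _ => ?_)
    simp [mul_comm]
  have h : D.compAlgebraMap (MvPolynomial σ k) = D₂ := by
    refine MvPolynomial.derivation_ext fun j => ?_
    rw [hD₂, Finset.sum_eq_single j]
    · simp
    · intro i _ hij
      simp [MvPolynomial.pderiv_X_of_ne hij.symm]
    · simp
  exact (congrArg (fun D' => D' p) h).trans (hD₂ p)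

section

variable {k : Type*} (κ : Type*) {σ : Type*} [Field k] [Field κ] [Algebra k κ]
  (K : Type*) [Field K] [Algebra (MvPolynomial σ k) K] [IsFractionRing (MvPolynomial σ k) K]
  [Algebra K κ] [FiniteDimensional K κ] [Algebra.IsSeparable K κ]
  [Algebra (MvPolynomial σ k) κ] [IsScalarTower (MvPolynomial σ k) K κ]
  (O : Type*) [CommRing O] [IsDomain O] [IsPrincipalIdealRing O] [Algebra O K]
  [IsFractionRing O K] [Algebra O κ] [IsScalarTower O K κ]

/-- Elements of `κ` integral over a polynomial ring and with bounded poles at infinity form a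
finite-dimensional space. -/
theorem exists_finiteDimensional_of_bounded_poles [Algebra k K]
    [IsScalarTower k (MvPolynomial σ k) K] [IsScalarTower k K κ] [Finite σ]
    (hO : ∀ p q : MvPolynomial σ k, q ≠ 0 → (p.totalDegree ≤ q.totalDegree ↔
      ∃ r : O, algebraMap O K r = algebraMap _ K p / algebraMap _ K q))
    (y : κ) (hy : y ≠ 0) :
    ∃ V : Submodule k κ, FiniteDimensional k V ∧
      ∀ a : κ, IsIntegral (MvPolynomial σ k) a → IsIntegral O (y * a) → a ∈ V := by
  classical
  let P := MvPolynomial σ k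
  have : Algebra.IsAlgebraic P κ :=
    (IsFractionRing.comap_isAlgebraic_iff (A := P) (K := K) (C := κ)).2 inferInstance
  have : Algebra.IsAlgebraic O κ :=
    (IsFractionRing.comap_isAlgebraic_iff (A := O) (K := K) (C := κ)).2 inferInstance
  obtain ⟨s, e, he⟩ := FiniteDimensional.exists_is_basis_integral P K κ
  have hinj : Function.Injective (algebraMap P K) := IsFractionRing.injective P K
  have hr : ∀ i : s, ∃ q : P, ∃ t : P, q ≠ 0 ∧ t ≠ 0 ∧
      IsIntegral O (algebraMap K κ (algebraMap P K t / algebraMap P K q) * (e i * y⁻¹)) := by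
    intro i
    obtain ⟨r, hr0, hr⟩ := (Algebra.IsAlgebraic.isAlgebraic (R := O) (e i * y⁻¹)
      ).exists_integral_multiple
    obtain ⟨t, q, hq, h⟩ := IsFractionRing.div_surjective (A := P) (algebraMap O K r)
    refine ⟨q, t, nonZeroDivisors.ne_zero hq, ?_, ?_⟩
    · rintro rfl
      simp at h
      exact hr0 ((FaithfulSMul.algebraMap_injective O K) (by rw [← h, map_zero]))
    · rw [h, ← IsScalarTower.algebraMap_apply, ← Algebra.smul_def]
      exact hr
  choose q t hq ht hint using hr
  let N : s → Submodule k K := fun i =>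
    (MvPolynomial.restrictTotalDegree σ k (q i).totalDegree).map
      (IsScalarTower.toAlgHom k P K).toLinearMap
  have hN : ∀ i, FiniteDimensional k (N i) := fun i => by
    have := MvPolynomial.finiteDimensional_restrictTotalDegree (σ := σ) (k := k) (q i).totalDegree
    infer_instance
  let T : κ →ₗ[k] (s → K) := LinearMap.pi fun i =>
    ((Algebra.traceForm K κ).flip (e i)).restrictScalars k
  have hT : Function.Injective T := by
    rw [injective_iff_map_eq_zero]
    intro z hz
    have h1 : Algebra.traceForm K κ z = 0 := by
      apply e.ext
      intro i
      exact congrFun hz i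
    exact (traceForm_nondegenerate K κ).1 z fun w => by rw [h1]; rfl
  let M : Submodule k (s → K) := Submodule.pi Set.univ N
  have hM : FiniteDimensional k M := by
    let g : (M) →ₗ[k] (∀ i, N i) := LinearMap.pi fun i =>
      ((LinearMap.proj i).comp M.subtype).codRestrict (N i) fun x => x.2 i trivial
    refine FiniteDimensional.of_injective g fun x y hxy => ?_
    ext i
    exact congrArg Subtype.val (congrFun hxy i)
  refine ⟨M.comap T, ?_, fun a ha hya => ?_⟩
  · let g : (M.comap T) →ₗ[k] M := T.restrict fun x hx => hx
    refine FiniteDimensional.of_injective g fun x y hxy => ?_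
    exact Subtype.ext (hT (congrArg Subtype.val hxy))
  · intro i _
    change Algebra.traceForm K κ a (e i) ∈ N i
    rw [Algebra.traceForm_apply]
    have h1 : IsIntegral P (Algebra.trace K κ (a * e i)) := Algebra.isIntegral_trace (ha.mul (he i))
    obtain ⟨p, hp⟩ := IsIntegrallyClosed.isIntegral_iff.1 h1
    refine ⟨p, ?_, hp⟩
    rw [SetLike.mem_coe, MvPolynomial.mem_restrictTotalDegree]
    by_cases hp0 : p = 0
    · simp [hp0]
    have h2 : IsIntegral O (Algebra.trace K κ ((y * a) *
      (algebraMap K κ (algebraMap P K (t i) / algebraMap P K (q i)) * (e i * y⁻¹)))) :=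
      Algebra.isIntegral_trace (hya.mul (hint i))
    have h3 : (y * a) * (algebraMap K κ (algebraMap P K (t i) / algebraMap P K (q i)) *
        (e i * y⁻¹)) = (algebraMap P K (t i) / algebraMap P K (q i)) • (a * e i) := by
      rw [Algebra.smul_def]
      field_simp
    rw [h3, map_smul, ← hp, smul_eq_mul] at h2
    obtain ⟨r, hr⟩ := IsIntegrallyClosed.isIntegral_iff.1 h2
    have h4 := (hO (t i * p) (q i) (hq i)).2 ⟨r, by rw [hr, map_mul]; ring⟩
    rw [MvPolynomial.totalDegree_mul_of_isDomain (ht i) hp0] at h4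
    omega

theorem exists_common_denominator_derivation [IsScalarTower k (MvPolynomial σ k) κ]
    [Finite σ]
    (hO : ∀ p q : MvPolynomial σ k, q ≠ 0 → (p.totalDegree ≤ q.totalDegree ↔
      ∃ r : O, algebraMap O K r = algebraMap _ K p / algebraMap _ K q))
    (D : Derivation k κ κ) :
    ∃ y : κ, y ≠ 0 ∧ IsIntegral O y ∧ ∀ b : κ, IsIntegral O b → IsIntegral O (y * D b) := by
  classical
  cases nonempty_fintype σ
  let P := MvPolynomial σ k
  have : Algebra.IsAlgebraic O κ :=
    (IsFractionRing.comap_isAlgebraic_iff (A := O) (K := K) (C := κ)).2 inferInstance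
  have hinjO : Function.Injective (algebraMap O κ) := by
    rw [IsScalarTower.algebraMap_eq O K κ]
    exact (algebraMap K κ).injective.comp (IsFractionRing.injective O K)
  obtain ⟨y₀, hy₀, hy⟩ := Algebra.IsAlgebraic.exists_integral_multiples O
    (Finset.univ.image fun i : σ => D (algebraMap P κ (MvPolynomial.X i)))
  have hO' : ∀ p q : P, q ≠ 0 → p.totalDegree ≤ q.totalDegree →
      IsIntegral O (algebraMap P κ p / algebraMap P κ q) := fun p q hq hpq => by
    obtain ⟨r, hr⟩ := (hO p q hq).1 hpq
    have : algebraMap P κ p / algebraMap P κ q = algebraMap O κ r := by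
      rw [IsScalarTower.algebraMap_apply O K κ, hr, map_div₀, ← IsScalarTower.algebraMap_apply,
        ← IsScalarTower.algebraMap_apply]
    rw [this]
    exact isIntegral_algebraMap
  have hP : ∀ p q : P, q ≠ 0 → p.totalDegree ≤ q.totalDegree →
      IsIntegral O (algebraMap O κ y₀ * (D (algebraMap P κ p) / algebraMap P κ q)) := by
    intro p q hq hpq
    rw [Derivation.apply_algebraMap_mvPolynomial, Finset.sum_div, Finset.mul_sum]
    refine IsIntegral.sum _ fun i _ => ?_
    have h1 := hO' (MvPolynomial.pderiv i p) q hq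
      ((MvPolynomial.totalDegree_pderiv_le i p).trans hpq)
    have h2 := hy _ (Finset.mem_image_of_mem _ (Finset.mem_univ i))
    rw [Algebra.smul_def] at h2
    convert! h1.mul h2 using 1
    ring
  have hr : ∀ r : O, IsIntegral O (algebraMap O κ y₀ * D (algebraMap O κ r)) := by
    intro r
    obtain ⟨p, q, hq, h⟩ := IsFractionRing.div_surjective (A := P) (algebraMap O K r)
    have hq0 : q ≠ 0 := nonZeroDivisors.ne_zero hq
    have hpq := (hO p q hq0).2 ⟨r, h.symm⟩
    have hqκ : algebraMap P κ q ≠ 0 := by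
      rw [IsScalarTower.algebraMap_apply P K κ]
      simpa using hq0
    have h' : algebraMap O κ r = algebraMap P κ p / algebraMap P κ q := by
      rw [IsScalarTower.algebraMap_apply O K κ, ← h, map_div₀, ← IsScalarTower.algebraMap_apply,
        ← IsScalarTower.algebraMap_apply]
    have h3 := (hP p q hq0 hpq).sub ((hO' p q hq0 hpq).mul (hP q q hq0 le_rfl))
    convert! h3 using 1
    rw [h', Derivation.leibniz_div]
    simp only [smul_eq_mul]
    field_simp
  have hfin : Module.Finite O (integralClosure O κ) := IsIntegralClosure.finite O K κ _
  obtain ⟨S, hS⟩ := hfin.fg_top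
  obtain ⟨y₁, hy₁, hy1⟩ := Algebra.IsAlgebraic.exists_integral_multiples O
    (S.image fun c : integralClosure O κ => D (c : κ))
  refine ⟨algebraMap O κ (y₀ * y₁), by
    simpa using ⟨(map_ne_zero_iff _ hinjO).2 hy₀, (map_ne_zero_iff _ hinjO).2 hy₁⟩,
      isIntegral_algebraMap,
    fun b hb => ?_⟩
  have hb' : (⟨b, hb⟩ : integralClosure O κ) ∈ Submodule.span O (S : Set (integralClosure O κ)) :=
    hS ▸ Submodule.mem_top
  suffices H : ∀ c ∈ Submodule.span O (S : Set (integralClosure O κ)),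
      IsIntegral O (algebraMap O κ (y₀ * y₁) * D (c : κ)) from H _ hb'
  intro c hc
  induction hc using Submodule.span_induction with
  | mem x hx =>
    have h2 := hy1 _ (Finset.mem_image_of_mem _ hx)
    rw [Algebra.smul_def] at h2
    rw [map_mul, mul_assoc]
    exact isIntegral_algebraMap.mul h2
  | zero => simp [isIntegral_zero]
  | add x y _ _ hx hy =>
    convert! hx.add hy using 1
    simp [mul_add]
  | smul r x _ hx =>
    have h1 := ((hr r).mul (isIntegral_algebraMap (x := y₁) (R := O) (A := κ))).mul x.2
    convert! (isIntegral_algebraMap (x := r) (R := O) (A := κ)).mul hx |>.add h1 using 1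
    have hv : ((r • x : integralClosure O κ) : κ) = algebraMap O κ r * x := by
      rw [← Algebra.smul_def]; rfl
    rw [hv, Derivation.leibniz, smul_eq_mul, smul_eq_mul, map_mul]
    ring

end

end

section

open scoped nonZeroDivisors

/-- In the function field `κ` of an affine variety with coordinate ring `A`, there is a ring `B` of
functions without poles at infinity. -/
theorem exists_pole_ring {k κ : Type*} [Field k] [CharZero k] [Field κ] [Algebra k κ]
    (A : Subalgebra k κ) (hA : A.FG)
    (hfrac : ∀ z : κ, ∃ a ∈ A, ∃ b ∈ A, b ≠ 0 ∧ z = a / b) :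
    ∃ B : Subring κ, (∀ c : k, algebraMap k κ c ∈ B) ∧
      (∀ z : κ, ∃ y ∈ B, y ≠ 0 ∧ y * z ∈ B) ∧
      (∃ r : ℕ, ∃ b : Fin r → κˣ, ∀ z : κˣ, ∃ e : Fin r → ℤ, ∃ w : κˣ,
        (w : κ) ∈ B ∧ ((w⁻¹ : κˣ) : κ) ∈ B ∧ z = w * ∏ i, b i ^ e i) ∧
      (∀ y : κ, y ≠ 0 → ∃ V : Submodule k κ, FiniteDimensional k V ∧
        ∀ a ∈ A, y * a ∈ B → a ∈ V) ∧
      (∀ D : Derivation k κ κ, ∃ y ∈ B, y ≠ 0 ∧ ∀ b ∈ B, y * D b ∈ B) := by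
  have hft : Algebra.FiniteType k A := A.fg_iff_finiteType.1 hA
  obtain ⟨s, g, hginj, hgfin⟩ := exists_finite_inj_algHom_of_fg k A
  let P := MvPolynomial (Fin s) k
  let K := FractionRing P
  let _ : Algebra P A := g.toRingHom.toAlgebra
  have _ : IsScalarTower k P A := IsScalarTower.of_algebraMap_eq fun c => (g.commutes c).symm
  have : Module.Finite P A := hgfin
  have : FaithfulSMul P A := (faithfulSMul_iff_algebraMap_injective P A).2 hginj
  let _ : Algebra P κ := (A.val.comp g).toRingHom.toAlgebra
  have : IsScalarTower k P κ := IsScalarTower.of_algebraMap_eq fun c =>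
    ((A.val.comp g).commutes c).symm
  have : IsScalarTower P A κ := IsScalarTower.of_algebraMap_eq fun c => rfl
  have : FaithfulSMul P κ := (faithfulSMul_iff_algebraMap_injective P κ).2
    (Subtype.val_injective.comp hginj)
  let _ : Algebra K κ := FractionRing.liftAlgebra P κ
  have : IsScalarTower P K κ := FractionRing.isScalarTower_liftAlgebra P κ
  have : IsScalarTower k K κ := IsScalarTower.of_algebraMap_eq fun c => by
    rw [IsScalarTower.algebraMap_apply k P κ, IsScalarTower.algebraMap_apply k P K,
      ← IsScalarTower.algebraMap_apply P K κ]
  have : IsFractionRing A κ := by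
    refine IsFractionRing.of_field A κ fun z => ?_
    obtain ⟨a, ha, b, hb, hb0, rfl⟩ := hfrac z
    exact ⟨⟨a, ha⟩, ⟨b, hb⟩, rfl⟩
  have : FiniteDimensional K κ := Module.Finite.of_isLocalization P A P⁰
  have : CharZero K := charZero_of_injective_algebraMap (algebraMap k K).injective
  let v₀ := MvPolynomial.totalDegreeValuation (Fin s) k
  have hv₀ : P⁰ ≤ v₀.supp.primeCompl := fun p hp h =>
    nonZeroDivisors.ne_zero hp (MvPolynomial.totalDegreeValuation_eq_zero.1 h)
  let v := v₀.extendToLocalization hv₀ K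
  have hv : ∀ p, v (algebraMap P K p) = v₀ p := v₀.extendToLocalization_apply_map_apply hv₀ K
  let O := v.valuationSubring
  let _ : Algebra O κ := ((algebraMap K κ).comp O.subtype).toAlgebra
  have : IsScalarTower O K κ := IsScalarTower.of_algebraMap_eq fun c => rfl
  have : IsPrincipalIdealRing O := v.isPrincipalIdealRing_valuationSubring
  have hO : ∀ p q : P, q ≠ 0 → (p.totalDegree ≤ q.totalDegree ↔
      ∃ r : O, algebraMap O K r = algebraMap _ K p / algebraMap _ K q) := fun p q hq => by
    have h1 : (∃ r : O, algebraMap O K r = algebraMap _ K p / algebraMap _ K q) ↔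
        v (algebraMap _ K p / algebraMap _ K q) ≤ 1 :=
      ⟨fun ⟨r, hr⟩ => hr ▸ r.2, fun h => ⟨⟨_, h⟩, rfl⟩⟩
    rw [h1, map_div₀, hv, hv, MvPolynomial.totalDegreeValuation_of_ne_zero hq]
    by_cases hp : p = 0
    · simp [hp]
    · rw [MvPolynomial.totalDegreeValuation_of_ne_zero hp, div_le_one₀ (by simp)]
      simp
  have hOalg : Algebra.IsAlgebraic O κ :=
    (IsFractionRing.comap_isAlgebraic_iff (A := O) (K := K) (C := κ)).2 inferInstance
  have hOinj : Function.Injective (algebraMap O κ) :=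
    (algebraMap K κ).injective.comp Subtype.val_injective
  refine ⟨(integralClosure O κ).toSubring, fun c => ?_, fun z => ?_, ?_, fun y hy => ?_,
    fun D => ?_⟩
  · obtain ⟨r, hr⟩ := (hO (MvPolynomial.C c) 1 one_ne_zero).1 (by simp)
    have : algebraMap k κ c = algebraMap O κ r := by
      rw [IsScalarTower.algebraMap_apply O K κ, hr, map_one, div_one,
        ← IsScalarTower.algebraMap_apply, ← MvPolynomial.algebraMap_eq,
        ← IsScalarTower.algebraMap_apply]
    rw [this]
    exact isIntegral_algebraMap
  · obtain ⟨y, hy, hyz⟩ := (hOalg.isAlgebraic z).exists_integral_multiple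
    exact ⟨algebraMap O κ y, isIntegral_algebraMap, (map_ne_zero_iff _ hOinj).2 hy,
      Algebra.smul_def y z ▸ hyz⟩
  · exact integralClosure.exists_finite_generators_units O K κ
  · obtain ⟨V, hV, h⟩ := exists_finiteDimensional_of_bounded_poles κ K O hO y hy
    refine ⟨V, hV, fun a ha hya => h a ?_ hya⟩
    exact (Algebra.IsIntegral.isIntegral (R := P) (⟨a, ha⟩ : A)).algebraMap (B := κ)
  · obtain ⟨y, hy0, hy, h⟩ := exists_common_denominator_derivation κ K O hO D
    exact ⟨y, hy, hy0, h⟩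

end

/-- The logarithmic derivative `x ↦ D x / x` attached to a derivation of a field. -/
def Derivation.dlog {k κ : Type*} [CommRing k] [Field κ] [Algebra k κ] (D : Derivation k κ κ) :
    Additive κˣ →+ κ where
  toFun x := D (x.toMul : κ) / (x.toMul : κ)
  map_zero' := by simp
  map_add' x y := by
    simp only [toMul_add, Units.val_mul, Derivation.leibniz, smul_eq_mul]
    field_simp
    ring

theorem Derivation.dlog_ofMul {k κ : Type*} [CommRing k] [Field κ] [Algebra k κ]
    (D : Derivation k κ κ) (x : κˣ) : D.dlog (Additive.ofMul x) = D (x : κ) / x := rfl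

theorem Derivation.dlog_prod_zpow {k κ ι : Type*} [CommRing k] [Field κ] [Algebra k κ]
    (D : Derivation k κ κ) (s : Finset ι) (x : ι → κˣ) (c : ι → ℤ) :
    D.dlog (Additive.ofMul (∏ i ∈ s, x i ^ c i)) =
      ∑ i ∈ s, (c i : κ) * D.dlog (Additive.ofMul (x i)) := by
  rw [ofMul_prod, map_sum]
  refine Finset.sum_congr rfl fun i _ => ?_
  rw [ofMul_zpow, map_zsmul, zsmul_eq_mul]

/-- Units of a finitely generated domain have finite rank modulo units algebraic over the
base field. -/
theorem RelFiniteRank.of_units {k κ Γ : Type*} [Field k] [CharZero k] [Field κ] [Algebra k κ]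
    [CommGroup Γ] (A : Subalgebra k κ) (hA : A.FG)
    (hfrac : ∀ z : κ, ∃ a ∈ A, ∃ b ∈ A, b ≠ 0 ∧ z = a / b)
    (u : Γ →* κˣ) (H H' : Subgroup Γ) (hu : ∀ γ ∈ H, (u γ : κ) ∈ A)
    (hH' : ∀ γ ∈ H, IsAlgebraic k (u γ : κ) → γ ∈ H') : RelFiniteRank H H' := by
  obtain ⟨B, hkB, -, ⟨r, b, hb⟩, hfin, -⟩ := exists_pole_ring A hA hfrac
  let W : Subgroup κˣ :=
    { carrier := {w | (w : κ) ∈ B ∧ ((w⁻¹ : κˣ) : κ) ∈ B}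
      one_mem' := ⟨by simp, by simp⟩
      mul_mem' := fun {x y} hx hy => ⟨by
        rw [Units.val_mul]; exact B.mul_mem hx.1 hy.1, by
        rw [mul_inv, Units.val_mul]; exact B.mul_mem hx.2 hy.2⟩
      inv_mem' := fun {x} hx => ⟨hx.2, by rw [inv_inv]; exact hx.1⟩ }
  have h1 : RelFiniteRank H (W.comap u) := RelFiniteRank.of_generators u W b fun γ _ => by
    obtain ⟨e, w, hw, hw', h⟩ := hb (u γ)
    exact ⟨e, w, ⟨hw, hw'⟩, h⟩
  refine h1.inf_right.mono fun γ hγ => hH' γ hγ.1 ?_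
  let C : Subalgebra k κ :=
    { carrier := {z | z ∈ A ∧ z ∈ B}
      mul_mem' := fun hx hy => ⟨A.mul_mem hx.1 hy.1, B.mul_mem hx.2 hy.2⟩
      add_mem' := fun hx hy => ⟨A.add_mem hx.1 hy.1, B.add_mem hx.2 hy.2⟩
      algebraMap_mem' := fun c => ⟨A.algebraMap_mem c, hkB c⟩ }
  obtain ⟨V, hV, h⟩ := hfin 1 one_ne_zero
  have hC : FiniteDimensional k C :=
    Submodule.finiteDimensional_of_le (S₁ := Subalgebra.toSubmodule C) (S₂ := V)
      fun z hz => h z hz.1 (by rw [one_mul]; exact hz.2)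
  have hz : (u γ : κ) ∈ C := ⟨hu γ hγ.1, hγ.2.1⟩
  exact ((Algebra.IsAlgebraic.isAlgebraic (R := k) (⟨u γ, hz⟩ : C)).algebraMap (A := κ))

/-- The logarithmic derivatives which are regular on an affine variety lie in a finite-dimensional
space. -/
theorem Derivation.exists_finiteDimensional_dlog {k κ : Type*} [Field k] [CharZero k] [Field κ]
    [Algebra k κ] (A : Subalgebra k κ) (hA : A.FG)
    (hfrac : ∀ z : κ, ∃ a ∈ A, ∃ b ∈ A, b ≠ 0 ∧ z = a / b) (D : Derivation k κ κ) :
    ∃ V : Submodule k κ, FiniteDimensional k V ∧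
      ∀ z : κˣ, D.dlog (Additive.ofMul z) ∈ A → D.dlog (Additive.ofMul z) ∈ V := by
  obtain ⟨B, hkB, hden, ⟨r, b, hb⟩, hfin, hder⟩ := exists_pole_ring A hA hfrac
  obtain ⟨y, hyB, hy0, hy⟩ := hder D
  choose d hdB hd0 hd using fun i => hden (D.dlog (Additive.ofMul (b i)))
  obtain ⟨V, hV, h⟩ := hfin (y * ∏ i, d i) (mul_ne_zero hy0 (Finset.prod_ne_zero_iff.2
    fun i _ => hd0 i))
  refine ⟨V, hV, fun z hz => h _ hz ?_⟩
  obtain ⟨e, w, hw, hw', rfl⟩ := hb z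
  have hdB' : ∏ i, d i ∈ B := B.prod_mem fun i _ => hdB i
  rw [ofMul_mul, map_add, D.dlog_prod_zpow, mul_add]
  refine B.add_mem ?_ ?_
  · have : y * (∏ i, d i) * D.dlog (Additive.ofMul w) =
        (∏ i, d i) * ((y * D w) * ((w⁻¹ : κˣ) : κ)) := by
      rw [D.dlog_ofMul, Units.val_inv_eq_inv_val]
      ring
    rw [this]
    exact B.mul_mem hdB' (B.mul_mem (hy _ hw) hw')
  · rw [Finset.mul_sum]
    refine B.sum_mem fun i _ => ?_
    classical
    rw [← Finset.mul_prod_erase Finset.univ d (Finset.mem_univ i)]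
    have : y * (d i * ∏ x ∈ Finset.univ.erase i, d x) *
        ((e i : κ) * D.dlog (Additive.ofMul (b i))) =
        y * (∏ x ∈ Finset.univ.erase i, d x) * (e i : κ) *
          (d i * D.dlog (Additive.ofMul (b i))) := by ring
    rw [this]
    exact B.mul_mem (B.mul_mem (B.mul_mem hyB (B.prod_mem fun i _ => hdB i)) (intCast_mem B _))
      (hd i)

open MvPolynomial in
/-- If the kernel of evaluation at `x` is stable under the scaling by `c` and nonzero, and no `x i`
vanishes, then the scalars `c i` are multiplicatively dependent. -/
theorem MvPolynomial.exists_prod_pow_eq_prod_pow_of_scaling {k κ σ : Type*} [Fintype σ] [Field k]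
    [Field κ] [Algebra k κ] (x : σ → κ) (hx : ∀ i, x i ≠ 0) (c : σ → k)
    (hc : ∀ p : MvPolynomial σ k, aeval x p = 0 →
      aeval (fun i => algebraMap k κ (c i) * x i) p = 0)
    (hdep : ∃ p : MvPolynomial σ k, p ≠ 0 ∧ aeval x p = 0) :
    ∃ m m' : σ →₀ ℕ, m ≠ m' ∧ ∏ i, c i ^ m i = ∏ i, c i ^ m' i := by
  classical
  have hex : ∃ n, ∃ p : MvPolynomial σ k, p ≠ 0 ∧ aeval x p = 0 ∧ p.support.card = n := by
    obtain ⟨p, hp, h⟩ := hdep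
    exact ⟨_, p, hp, h, rfl⟩
  obtain ⟨p, hp0, hp, hcard⟩ := Nat.find_spec hex
  have hmin := fun q => Nat.find_min hex (m := q)
  obtain ⟨m, hm⟩ := support_nonempty.2 hp0
  by_cases hsub : ∃ m' ∈ p.support, m ≠ m'
  · obtain ⟨m', hm', hne⟩ := hsub
    let q : MvPolynomial σ k :=
      ∑ l ∈ p.support, monomial l ((∏ i, c i ^ l i - ∏ i, c i ^ m i) * coeff l p)
    have hcoeff : ∀ l, coeff l q = (∏ i, c i ^ l i - ∏ i, c i ^ m i) * coeff l p := by
      intro l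
      simp only [q, coeff_sum, coeff_monomial, Finset.sum_ite_eq', mem_support_iff]
      split_ifs with h
      · rfl
      · rw [not_not.1 h, mul_zero]
    have hq : aeval x q = 0 := by
      have h1 := hc p hp
      rw [aeval_def, eval₂_eq'] at h1 hp
      have : aeval x q = (∑ l ∈ p.support, algebraMap k κ (coeff l p) *
          ∏ i, (algebraMap k κ (c i) * x i) ^ l i) - algebraMap k κ (∏ i, c i ^ m i) *
          ∑ l ∈ p.support, algebraMap k κ (coeff l p) * ∏ i, x i ^ l i := by
        simp only [q, map_sum, aeval_monomial, Finset.mul_sum, ← Finset.sum_sub_distrib]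
        refine Finset.sum_congr rfl fun l _ => ?_
        rw [Finsupp.prod_fintype _ _ fun _ => pow_zero _]
        simp only [mul_pow, Finset.prod_mul_distrib, map_mul, map_sub, map_prod, map_pow]
        ring
      rw [this, h1, hp, mul_zero, sub_zero]
    have hlt : q.support.card < p.support.card := by
      refine Finset.card_lt_card ⟨fun l hl => ?_, fun h => ?_⟩
      · rw [mem_support_iff, hcoeff] at hl
        exact mem_support_iff.2 (right_ne_zero_of_mul hl)
      · have := h hm
        rw [mem_support_iff, hcoeff, sub_self, zero_mul] at this
        exact this rfl
    have hq0 : q = 0 := by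
      by_contra hq0
      exact hmin _ (hcard ▸ hlt) ⟨q, hq0, hq, rfl⟩
    have h2 := hcoeff m'
    rw [hq0, coeff_zero, eq_comm, mul_eq_zero] at h2
    exact ⟨m, m', hne, (sub_eq_zero.1 (h2.resolve_right (mem_support_iff.1 hm'))).symm⟩
  · push Not at hsub
    have hs : p.support = {m} := Finset.eq_singleton_iff_unique_mem.2
      ⟨hm, fun l hl => (hsub l hl).symm⟩
    rw [aeval_def, eval₂_eq', hs, Finset.sum_singleton, mul_eq_zero] at hp
    rcases hp with hp | hp
    · exact absurd ((map_eq_zero _).1 hp) (mem_support_iff.1 hm)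
    · exact absurd hp (Finset.prod_ne_zero_iff.2 fun i _ => pow_ne_zero _ (hx i))

theorem RelFiniteRank.of_eq_mul_scalar {k E κ Γ : Type*} [Field k] [Field E] [Field κ] [CommGroup Γ]
    [Algebra k E] [Algebra k κ] {n : ℕ} (hn : ∀ x : Fin n → κ, ¬ AlgebraicIndependent k x)
    (F₁ F₂ : E →ₐ[k] κ) (g : Γ →* Eˣ) (H H' : Subgroup Γ)
    (hH : ∀ γ ∈ H, ∃ c : k, F₁ (g γ) = algebraMap k κ c * F₂ (g γ))
    (hH' : ∀ γ, F₁ (g γ) = F₂ (g γ) → γ ∈ H') : RelFiniteRank H H' := by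
  refine ⟨n, fun v hv => ?_⟩
  choose c hc using fun i => hH _ (hv i)
  have hx : ∀ i, F₂ (g (v i)) ≠ 0 := fun i => by simp
  have hc0 : ∀ i, c i ≠ 0 := fun i h => by
    have := hc i
    rw [h, map_zero, zero_mul] at this
    simp at this
  have hE : ∀ (F : E →ₐ[k] κ) (p : MvPolynomial (Fin n) k),
      MvPolynomial.aeval (fun i => F (g (v i))) p = 0 ↔
      MvPolynomial.aeval (fun i => ((g (v i) : Eˣ) : E)) p = 0 := fun F p => by
    rw [← map_eq_zero F, MvPolynomial.comp_aeval_apply]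
  obtain ⟨m, m', hne, h⟩ := MvPolynomial.exists_prod_pow_eq_prod_pow_of_scaling
    (fun i => F₂ (g (v i))) hx c
    (fun p hp => by
      have := (hE F₁ p).2 ((hE F₂ p).1 hp)
      simpa only [hc] using this)
    (by
      have := hn fun i => F₂ (g (v i))
      rw [algebraicIndependent_iff] at this
      push Not at this
      obtain ⟨p, hp, hp0⟩ := this
      exact ⟨p, hp0, hp⟩)
  refine ⟨fun i => (m i : ℤ) - m' i, fun h0 => hne ?_, hH' _ ?_⟩
  · ext i
    have := congrFun h0 i
    simp only [Pi.zero_apply] at this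
    omega
  · have hcc : ∏ i, c i ^ ((m i : ℤ) - m' i) = 1 := by
      simp only [zpow_sub₀ (hc0 _), zpow_natCast, Finset.prod_div_distrib]
      rw [h, div_self (Finset.prod_ne_zero_iff.2 fun i _ => pow_ne_zero _ (hc0 i))]
    have hF : ∀ F : E →ₐ[k] κ, F (g (∏ i, v i ^ ((m i : ℤ) - m' i)) : Eˣ) =
        ∏ i, F (g (v i)) ^ ((m i : ℤ) - m' i) := fun F => by
      simp only [map_prod, map_zpow, Units.coe_prod, Units.val_zpow_eq_zpow_val, map_zpow₀]
    rw [hF, hF]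
    simp only [hc, mul_zpow, Finset.prod_mul_distrib]
    have hcc' := congrArg (algebraMap k κ) hcc
    simp only [map_prod, map_zpow₀, map_one] at hcc'
    rw [hcc', one_mul]

/-- Ring homomorphisms lift along square-zero thickenings of a formally smooth algebra. -/
theorem Algebra.FormallySmooth.exists_ringHom_lift {E κ B : Type*} [CommRing E] [CommRing κ]
    [CommRing B] [Algebra E κ] [Algebra.FormallySmooth E κ] (φ : E →+* B) (π : B →+* κ)
    (hπ : Function.Surjective π) (hker : IsNilpotent (RingHom.ker π))
    (h : ∀ x, π (φ x) = algebraMap E κ x) :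
    ∃ f : κ →+* B, (∀ x, f (algebraMap E κ x) = φ x) ∧ ∀ x, π (f x) = x := by
  let _ : Algebra E B := φ.toAlgebra
  let π' : B →ₐ[E] κ := { π with commutes' := h }
  refine ⟨(FormallySmooth.liftOfSurjective (AlgHom.id E κ) π' hπ hker : κ →ₐ[E] B),
    fun x => ?_, fun x => ?_⟩
  · exact AlgHom.commutes _ x
  · exact FormallySmooth.liftOfSurjective_apply (AlgHom.id E κ) π' hπ hker x

/-- Derivations extend along formally smooth algebras. -/
theorem Derivation.exists_extension {k E κ : Type*} [CommRing k] [CommRing E] [CommRing κ]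
    [Algebra k E] [Algebra k κ] [Algebra E κ] [IsScalarTower k E κ] [Algebra.FormallySmooth E κ]
    (D : Derivation k E κ) :
    ∃ D' : Derivation k κ κ, ∀ x, D' (algebraMap E κ x) = D x := by
  let φ : E →+* TrivSqZeroExt κ κ :=
    { toFun := fun x => TrivSqZeroExt.inl (algebraMap E κ x) + TrivSqZeroExt.inr (D x)
      map_one' := by ext <;> simp
      map_zero' := by ext <;> simp
      map_mul' := fun x y => by ext <;> simp [Algebra.smul_def (R := E) (A := κ), mul_comm]
      map_add' := fun x y => by ext <;> simp }
  obtain ⟨f, hf, hf'⟩ := Algebra.FormallySmooth.exists_ringHom_lift φ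
    (TrivSqZeroExt.fstHom κ κ κ : TrivSqZeroExt κ κ →+* κ)
    (fun x => ⟨TrivSqZeroExt.inl x, by simp⟩)
    ⟨2, TrivSqZeroExt.kerIdeal_sq κ κ⟩ (fun x => by simp [φ])
  replace hf' : ∀ x, (f x).fst = x := hf'
  have hmul : ∀ x y, (f (x * y)).snd = x * (f y).snd + y * (f x).snd := fun x y => by
    rw [map_mul, TrivSqZeroExt.snd_mul, hf', hf']; simp [mul_comm]
  have hk : ∀ c, (f (algebraMap k κ c)).snd = 0 := fun c => by
    rw [IsScalarTower.algebraMap_apply k E κ, hf]; simp [φ]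
  refine ⟨Derivation.mk' { toFun := fun x => (f x).snd
                           map_add' := fun x y => by simp
                           map_smul' := fun c x => ?_ } hmul, fun x => ?_⟩
  · rw [Algebra.smul_def, hmul, hk, RingHom.id_apply, Algebra.smul_def, mul_zero, add_zero]
  · simp [hf, φ]

/-- Derivations of a separable algebraic extension which agree on the base field are equal. -/
theorem Derivation.eq_zero_of_isAlgebraic {k K κ M : Type*} [CommRing k] [Field K] [CharZero K]
    [Field κ] [Algebra k κ] [Algebra K κ] [AddCommGroup M] [Module κ M] [Module k M]
    (D : Derivation k κ M) (hD : ∀ c, D (algebraMap K κ c) = 0) {x : κ} (hx : IsAlgebraic K x) :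
    D x = 0 := by
  have hpoly : ∀ p : Polynomial K,
      D (Polynomial.aeval x p) = Polynomial.aeval x (Polynomial.derivative p) • D x := fun p => by
    induction p using Polynomial.induction_on' with
    | add p q hp hq => simp [hp, hq, add_smul]
    | monomial n a =>
      rw [Polynomial.aeval_monomial, Derivation.leibniz, hD, smul_zero, add_zero,
        Derivation.leibniz_pow, Polynomial.derivative_monomial, Polynomial.aeval_monomial,
        ← Nat.cast_smul_eq_nsmul κ, smul_smul, smul_smul, map_mul,
        _root_.map_natCast (algebraMap K κ)]
  have h := hpoly (minpoly K x)
  rw [minpoly.aeval, map_zero] at h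
  refine (smul_eq_zero.mp h.symm).resolve_left ?_
  exact (minpoly.irreducible hx.isIntegral).separable.aeval_derivative_ne_zero (minpoly.aeval K x)

open Polynomial in
/-- Residues at the origin of logarithmic differentials on the projective line. -/
theorem exists_residue_dlog_fractionRing {F K : Type*} [Field F] [CharZero F] [Field K]
    [Algebra F K] [Algebra F[X] K] [IsScalarTower F F[X] K] [IsFractionRing F[X] K]
    (D : Derivation F K K) (hD : D (algebraMap F[X] K X) = algebraMap F[X] K X) (t : Kˣ)
    (ht : (t : K) = algebraMap F[X] K X) :
    ∃ n : Additive Kˣ →+ ℤ, n (Additive.ofMul t) = 1 ∧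
      ∀ (J : Type) [Fintype J] (γ : J → F) (z : J → Kˣ),
        ∑ j, algebraMap F K (γ j) * D.dlog (Additive.ofMul (z j)) = 0 →
        ∑ j, γ j * (n (Additive.ofMul (z j)) : F) = 0 := by
  have hinj := IsFractionRing.injective F[X] K
  let N : Submodule F K :=
    { carrier := {z | ∃ a q : F[X], ¬ X ∣ q ∧
        z * algebraMap F[X] K q = algebraMap F[X] K (X * a)}
      zero_mem' := ⟨0, 1, prime_X.not_dvd_one, by simp⟩
      add_mem' := by
        rintro x y ⟨a, q, hq, h⟩ ⟨a', q', hq', h'⟩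
        refine ⟨a * q' + a' * q, q * q', fun hd => (prime_X.dvd_or_dvd hd).elim hq hq', ?_⟩
        simp only [map_mul, map_add] at h h' ⊢
        linear_combination algebraMap F[X] K q' * h + algebraMap F[X] K q * h'
      smul_mem' := by
        rintro c x ⟨a, q, hq, h⟩
        refine ⟨C c * a, q, hq, ?_⟩
        rw [Algebra.smul_def, IsScalarTower.algebraMap_apply F F[X] K, ← C_eq_algebraMap]
        simp only [map_mul] at h ⊢
        linear_combination algebraMap F[X] K (C c) * h }
  have hN : ∀ c : F, algebraMap F K c ∈ N → c = 0 := by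
    rintro c ⟨a, q, hq, h⟩
    by_contra hc
    rw [IsScalarTower.algebraMap_apply F F[X] K, ← map_mul] at h
    have h' := hinj h
    rw [← C_eq_algebraMap] at h'
    refine hq ?_
    have : q = X * (C c⁻¹ * a) := by
      rw [mul_left_comm, ← h', ← mul_assoc, ← C_mul, inv_mul_cancel₀ hc, C_1, one_mul]
    exact ⟨_, this⟩
  have hDt : D.dlog (Additive.ofMul t) = 1 := by
    rw [Derivation.dlog_ofMul, ht, hD, div_self]
    rw [← ht]; exact t.ne_zero
  have hDp : ∀ p : F[X], D (algebraMap F[X] K p) = algebraMap F[X] K (X * derivative p) := by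
    intro p
    have h := D.map_aeval p (algebraMap F[X] K X)
    have h2 : ∀ p : F[X], aeval (algebraMap F[X] K X) p = algebraMap F[X] K p := fun p => by
      rw [aeval_algebraMap_apply, aeval_X_left_apply]
    rw [h2, h2, hD, smul_eq_mul, ← map_mul, mul_comm] at h
    exact h
  have hpoly : ∀ (f : Kˣ) (p : F[X]), (f : K) = algebraMap F[X] K p →
      ∃ m : ℤ, D.dlog (Additive.ofMul f) - algebraMap F K m ∈ N := by
    intro f p hf
    have hp : p ≠ 0 := by rintro rfl; simp at hf
    obtain ⟨q, hq, hnd⟩ := exists_eq_pow_rootMultiplicity_mul_and_not_dvd p hp 0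
    rw [C_0, sub_zero] at hq hnd
    generalize rootMultiplicity 0 p = m at hq
    have hq0 : algebraMap F[X] K q ≠ 0 := by
      intro h0
      rw [hq, map_mul, h0, mul_zero] at hf
      exact f.ne_zero hf
    have hfu : f = t ^ m * Units.mk0 _ hq0 := by
      ext; rw [hf, hq]; simp [ht]
    refine ⟨m, derivative q, q, hnd, ?_⟩
    rw [hfu, ofMul_mul, ofMul_pow, map_add, map_nsmul, hDt, Derivation.dlog_ofMul, Units.val_mk0,
      hDp]
    simp only [nsmul_eq_mul, mul_one, Int.cast_natCast, map_natCast, add_sub_cancel_left]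
    field_simp
  have hex : ∀ f : Kˣ, ∃ m : ℤ, D.dlog (Additive.ofMul f) - algebraMap F K m ∈ N := by
    intro f
    obtain ⟨p, q, hq, hf⟩ := IsFractionRing.div_surjective (A := F[X]) (f : K)
    have hq0 : algebraMap F[X] K q ≠ 0 := by
      simpa using nonZeroDivisors.ne_zero hq
    have hp0 : algebraMap F[X] K p ≠ 0 := by
      intro h0; rw [h0, zero_div] at hf; exact f.ne_zero hf.symm
    obtain ⟨m₁, h₁⟩ := hpoly (Units.mk0 _ hp0) p rfl
    obtain ⟨m₂, h₂⟩ := hpoly (Units.mk0 _ hq0) q rfl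
    have hfu : f = Units.mk0 _ hp0 / Units.mk0 _ hq0 := by
      ext; simp [hf]
    refine ⟨m₁ - m₂, ?_⟩
    convert! N.sub_mem h₁ h₂ using 1
    rw [hfu, ofMul_div, map_sub, Int.cast_sub, map_sub]
    ring
  choose n hn using hex
  have huniq : ∀ (f : Kˣ) (m : ℤ), D.dlog (Additive.ofMul f) - algebraMap F K m ∈ N →
      n f = m := by
    intro f m hm
    have h := N.sub_mem hm (hn f)
    rw [sub_sub_sub_cancel_left, ← map_sub] at h
    exact_mod_cast sub_eq_zero.mp (hN _ h)
  let n' : Additive Kˣ →+ ℤ := AddMonoidHom.mk' (fun f => n f.toMul) fun x y => by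
    refine huniq _ _ ?_
    convert! N.add_mem (hn x.toMul) (hn y.toMul) using 1
    simp only [toMul_add, ofMul_mul, map_add, ofMul_toMul, Int.cast_add]
    ring
  refine ⟨n', huniq _ _ ?_, fun J _ γ z hz => hN _ ?_⟩
  · rw [ofMul_toMul, hDt, Int.cast_one, map_one, sub_self]; exact N.zero_mem
  · have h := N.sum_mem fun j (_ : j ∈ Finset.univ) => N.smul_mem (-γ j) (hn (z j))
    convert! h using 1
    simp only [Algebra.smul_def, map_neg, mul_sub, neg_mul, sub_neg_eq_add, Finset.sum_add_distrib,
      Finset.sum_neg_distrib, hz, map_sum, map_mul, n']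
    simp

/-- A derivation of a base field, its extension to a finite extension, and the norm. -/
theorem Derivation.dlog_norm {F K κ : Type*} [Field F] [Field K] [CharZero K]
    [Field κ] [Algebra F K] [Algebra K κ] [Algebra F κ] [IsScalarTower F K κ]
    [FiniteDimensional K κ] (D : Derivation F K K) (D' : Derivation F κ κ)
    (hD : ∀ x, D' (algebraMap K κ x) = algebraMap K κ (D x)) {J : Type*} [Fintype J] (γ : J → F)
    (z : J → κˣ) (h : ∑ j, algebraMap F κ (γ j) * D'.dlog (Additive.ofMul (z j)) = 0) :
    ∑ j, algebraMap F K (γ j) * D.dlog (Additive.ofMul (Units.map (Algebra.norm K) (z j))) = 0 := by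
  let Ω := AlgebraicClosure K
  have : Algebra.FormallyEtale K Ω := Algebra.FormallyEtale.of_isSeparable K Ω
  obtain ⟨E, hE⟩ := Derivation.exists_extension (κ := Ω) ((Algebra.linearMap K Ω).compDer D)
  replace hE : ∀ x, E (algebraMap K Ω x) = algebraMap K Ω (D x) := hE
  have hcomm : ∀ (σ : κ →ₐ[K] Ω) (x : κ), E (σ x) = σ (D' x) := by
    intro σ x
    let _ : Algebra κ Ω := σ.toRingHom.toAlgebra
    have hsmul : ∀ (a : κ) (b : Ω), a • b = σ a * b := fun a b => rfl
    have hF : ∀ (c : F) (y : κ), σ (c • y) = c • σ y := fun c y => by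
      rw [Algebra.smul_def, Algebra.smul_def, map_mul, IsScalarTower.algebraMap_apply F K κ,
        σ.commutes, ← IsScalarTower.algebraMap_apply]
    let δ : Derivation F κ Ω := Derivation.mk'
      { toFun := fun x => E (σ x) - σ (D' x)
        map_add' := fun x y => by simp only [map_add]; abel
        map_smul' := fun c x => by
          change E (σ (c • x)) - σ (D' (c • x)) = c • (E (σ x) - σ (D' x))
          rw [D'.map_smul, hF, hF, E.map_smul, smul_sub] }
      fun a b => by
        simp only [LinearMap.coe_mk, AddHom.coe_mk, map_mul, Derivation.leibniz, smul_eq_mul,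
          map_add, hsmul]
        ring
    refine sub_eq_zero.mp (δ.eq_zero_of_isAlgebraic (K := K) (x := x) (fun c => ?_)
      (Algebra.IsAlgebraic.isAlgebraic x))
    change E (σ (algebraMap K κ c)) - σ (D' (algebraMap K κ c)) = 0
    rw [σ.commutes, hE, hD, σ.commutes, sub_self]
  refine FaithfulSMul.algebraMap_injective K Ω ?_
  have hnorm : ∀ y : κˣ, algebraMap K Ω (D.dlog (Additive.ofMul (Units.map (Algebra.norm K) y))) =
      ∑ σ : κ →ₐ[K] Ω, E.dlog (Additive.ofMul (Units.map (σ : κ →* Ω) y)) := by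
    intro y
    rw [← map_sum, ← ofMul_prod, Derivation.dlog_ofMul, Derivation.dlog_ofMul, map_div₀, ← hE]
    have : ((∏ σ : κ →ₐ[K] Ω, Units.map (σ : κ →* Ω) y : Ωˣ) : Ω) =
        algebraMap K Ω (Algebra.norm K (y : κ)) := by
      rw [Algebra.norm_eq_prod_embeddings, Units.coe_prod]
      rfl
    rw [this]
    rfl
  rw [map_zero, map_sum]
  simp only [map_mul, hnorm, Finset.mul_sum]
  rw [Finset.sum_comm]
  refine Finset.sum_eq_zero fun σ _ => ?_
  have h' := congrArg σ h
  rw [map_zero, map_sum] at h'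
  rw [← h']
  refine Finset.sum_congr rfl fun j _ => ?_
  rw [map_mul, Derivation.dlog_ofMul, Derivation.dlog_ofMul, map_div₀, ← hcomm,
    IsScalarTower.algebraMap_apply F K κ, σ.commutes]
  rfl

open Polynomial in
theorem exists_residue_dlog_of_isAlgebraic_adjoin {F κ : Type*} [Field F] [CharZero F] [Field κ]
    [Algebra F κ] [Algebra.EssFiniteType F κ] (t : κˣ) (ht : Transcendental F (t : κ))
    [Algebra.IsAlgebraic (Algebra.adjoin F {(t : κ)}) κ] :
    ∃ n : Additive κˣ →+ ℤ, n (Additive.ofMul t) ≠ 0 ∧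
      ∀ (J : Type) [Fintype J] (γ : J → F) (z : J → κˣ),
        (∀ D : Derivation F κ κ,
          ∑ j, algebraMap F κ (γ j) * D.dlog (Additive.ofMul (z j)) = 0) →
        ∑ j, γ j * (n (Additive.ofMul (z j)) : F) = 0 := by
  let _ : Algebra F[X] κ := (aeval (t : κ)).toRingHom.toAlgebra
  have halg : ∀ p : F[X], algebraMap F[X] κ p = aeval (t : κ) p := fun _ => rfl
  have _ : FaithfulSMul F[X] κ := (faithfulSMul_iff_algebraMap_injective _ _).mpr
    (transcendental_iff_injective.mp ht)
  have _ : IsScalarTower F F[X] κ := IsScalarTower.of_algebraMap_eq fun c => by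
    rw [halg, ← C_eq_algebraMap, aeval_C]
  let K := FractionRing F[X]
  let _ : Algebra K κ := FractionRing.liftAlgebra F[X] κ
  have _ : IsScalarTower F[X] K κ := FractionRing.isScalarTower_liftAlgebra F[X] κ
  have _ : IsScalarTower F K κ := IsScalarTower.of_algebraMap_eq fun c => by
    rw [IsScalarTower.algebraMap_apply F F[X] K, ← IsScalarTower.algebraMap_apply F[X] K κ,
      ← IsScalarTower.algebraMap_apply F F[X] κ]
  have _ : CharZero K := charZero_of_injective_algebraMap (algebraMap F K).injective
  have _ : Algebra.IsAlgebraic F[X] κ := by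
    let f : F[X] →+* Algebra.adjoin F {(t : κ)} :=
      (aeval (t : κ)).toRingHom.codRestrict (Algebra.adjoin F {(t : κ)}) fun p =>
        aeval_mem_adjoin_singleton F (t : κ)
    refine Algebra.IsAlgebraic.of_ringHom_of_comp_eq (S := Algebra.adjoin F {(t : κ)}) (B := κ)
      f (RingHom.id κ) ?_ Function.injective_id rfl
    rintro ⟨x, hx⟩
    rw [Algebra.adjoin_singleton_eq_range_aeval] at hx
    obtain ⟨p, hp⟩ := hx
    exact ⟨p, Subtype.ext hp⟩
  have _ : Algebra.IsAlgebraic K κ :=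
    (IsFractionRing.comap_isAlgebraic_iff (A := F[X]) (K := K) (C := κ)).mp inferInstance
  have _ : Algebra.EssFiniteType K κ := Algebra.EssFiniteType.of_comp F K κ
  have _ : FiniteDimensional K κ := Algebra.finite_of_essFiniteType_of_isAlgebraic
  have _ : Algebra.FormallySmooth F[X] K :=
    Algebra.FormallySmooth.of_isLocalization (nonZeroDivisors F[X])
  have _ : Algebra.FormallyEtale K κ := Algebra.FormallyEtale.of_isSeparable K κ
  obtain ⟨D, hD⟩ := Derivation.exists_extension (κ := K)
    (mkDerivation F (algebraMap F[X] K X) : Derivation F F[X] K)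
  obtain ⟨D', hD'⟩ := Derivation.exists_extension (κ := κ) ((Algebra.linearMap K κ).compDer D)
  have hX : algebraMap F[X] K X ≠ 0 := by simp [X_ne_zero]
  obtain ⟨n, hn, h⟩ := exists_residue_dlog_fractionRing D
    (by rw [hD, mkDerivation_X]) (Units.mk0 _ hX) rfl
  refine ⟨n.comp (Units.map (Algebra.norm K)).toAdditive, ?_, fun J _ γ z hz => ?_⟩
  · have : (Units.map (Algebra.norm K)) t = (Units.mk0 _ hX) ^ Module.finrank K κ := by
      ext
      rw [Units.coe_map, Units.val_pow_eq_pow_val, Units.val_mk0]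
      change Algebra.norm K (t : κ) = _
      rw [← Algebra.norm_algebraMap, ← IsScalarTower.algebraMap_apply, halg, aeval_X]
    rw [AddMonoidHom.comp_apply]
    change n (Additive.ofMul (Units.map (Algebra.norm K) t)) ≠ 0
    rw [this, ofMul_pow, map_nsmul, hn]
    simpa using Module.finrank_pos.ne'
  · exact h J γ _ (D.dlog_norm D' hD' γ z (hz D'))

/-- If `t` is transcendental, then there is a divisorial valuation, trivial on the constants,
nontrivial on `t`, and annihilating all relations between logarithmic differentials. -/
theorem exists_residue_dlog {F κ : Type*} [Field F] [CharZero F] [Field κ]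
    [Algebra F κ] [Algebra.EssFiniteType F κ] (t : κˣ) (ht : Transcendental F (t : κ)) :
    ∃ n : Additive κˣ →+ ℤ, n (Additive.ofMul t) ≠ 0 ∧
      ∀ (J : Type) [Fintype J] (γ : J → F) (z : J → κˣ),
        (∀ D : Derivation F κ κ,
          ∑ j, algebraMap F κ (γ j) * D.dlog (Additive.ofMul (z j)) = 0) →
        ∑ j, γ j * (n (Additive.ofMul (z j)) : F) = 0 := by
  have hs : AlgebraicIndepOn F id {(t : κ)} :=
    (algebraicIndependent_unique_type_iff (R := F) (x := ((↑) : ({(t : κ)} : Set κ) → κ))).mpr ht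
  obtain ⟨s, hts, hs⟩ := exists_isTranscendenceBasis_superset hs
  rw [Set.singleton_subset_iff] at hts
  let L := IntermediateField.adjoin F (s \ {(t : κ)})
  have _ : Algebra.EssFiniteType L κ := Algebra.EssFiniteType.of_comp F L κ
  have htL : Transcendental L (t : κ) := by
    rw [IntermediateField.transcendental_adjoin_iff]
    have h := hs.1.transcendental_adjoin (s := {x : s | (x : κ) ≠ t}) (i := ⟨t, hts⟩) (by simp)
    have himg : (Subtype.val '' {x : s | (x : κ) ≠ t}) = s \ {(t : κ)} := by
      ext x
      simp [and_comm]
    rwa [himg] at h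
  have _ : Algebra.IsAlgebraic (Algebra.adjoin L {(t : κ)}) κ := by
    have h1 : Algebra.IsAlgebraic (Algebra.adjoin F s) κ := by
      have h := hs.isAlgebraic
      rwa [Subtype.range_coe] at h
    have hL : ∀ y : L, (y : κ) ∈ Algebra.adjoin L {(t : κ)} := fun y =>
      Subalgebra.algebraMap_mem _ y
    have hle : Algebra.adjoin F s ≤ (Algebra.adjoin L {(t : κ)}).restrictScalars F := by
      refine Algebra.adjoin_le fun x hx => (Subalgebra.mem_restrictScalars F).mpr ?_
      by_cases hxt : x = t
      · exact Algebra.subset_adjoin hxt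
      · have hxL : x ∈ L := IntermediateField.subset_adjoin F _ ⟨hx, hxt⟩
        exact hL ⟨x, hxL⟩
    exact Algebra.IsAlgebraic.ringHom_of_comp_eq (Subalgebra.inclusion hle) (RingHom.id κ)
      (Subalgebra.inclusion_injective hle) Function.surjective_id rfl
  obtain ⟨n, hn, h⟩ := exists_residue_dlog_of_isAlgebraic_adjoin t htL
  refine ⟨n, hn, fun J _ γ z hz => ?_⟩
  have h2 := h J (fun j => algebraMap F L (γ j)) z fun D => by
    convert! hz (D.restrictScalars F) using 1
  refine (algebraMap F L).injective ?_
  rw [map_zero, ← h2, map_sum]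
  simp

/-- A linear relation between logarithmic differentials yields a multiplicative relation modulo
algebraic elements. -/
theorem exists_prod_zpow_isAlgebraic {F κ : Type*} [Field F] [CharZero F] [Field κ]
    [Algebra F κ] [Algebra.EssFiniteType F κ] {J : Type} [Fintype J] (γ : J → F) (hγ : γ ≠ 0)
    (z : J → κˣ)
    (h : ∀ D : Derivation F κ κ,
      ∑ j, algebraMap F κ (γ j) * D.dlog (Additive.ofMul (z j)) = 0) :
    ∃ q : J → ℤ, q ≠ 0 ∧ IsAlgebraic F ((∏ j, z j ^ q j : κˣ) : κ) := by
  obtain ⟨j₀, hj₀⟩ := Function.ne_iff.mp hγ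
  obtain ⟨φ, hφ⟩ : ∃ φ : Module.Dual ℚ F, φ (γ j₀) ≠ 0 := by
    by_contra! hall
    exact hj₀ ((Module.forall_dual_apply_eq_zero_iff ℚ (γ j₀)).mp hall)
  obtain ⟨b, hb⟩ := IsLocalization.exist_integer_multiples_of_finite (nonZeroDivisors ℤ)
    (fun j => φ (γ j))
  choose q hq using hb
  have hb0 : (b : ℤ) ≠ 0 := nonZeroDivisors.ne_zero b.2
  have hq' : ∀ j, (q j : ℚ) = (b : ℤ) * φ (γ j) := fun j => by
    have := hq j
    simpa [zsmul_eq_mul] using this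
  refine ⟨q, fun h0 => ?_, ?_⟩
  · have := hq' j₀
    rw [h0] at this
    simp only [Pi.zero_apply, Int.cast_zero, zero_eq_mul, Int.cast_eq_zero] at this
    exact this.elim hb0 hφ
  by_contra halg
  obtain ⟨n, hn, hrel⟩ := exists_residue_dlog _ halg
  refine hn ?_
  have h1 := congrArg φ (hrel J γ z h)
  rw [map_zero, map_sum] at h1
  have h2 : ∀ j, φ (γ j * (n (Additive.ofMul (z j)) : F)) =
      φ (γ j) * n (Additive.ofMul (z j)) := fun j => by
    rw [mul_comm, ← zsmul_eq_mul, map_zsmul, zsmul_eq_mul, mul_comm]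
  simp only [h2] at h1
  have h3 : (n (Additive.ofMul (∏ j, z j ^ q j)) : ℚ) = 0 := by
    rw [ofMul_prod, map_sum, Int.cast_sum]
    simp only [ofMul_zpow, map_zsmul, smul_eq_mul, Int.cast_mul, hq', mul_assoc]
    rw [← Finset.mul_sum, h1, mul_zero]
  exact_mod_cast h3

/-- A nonzero space of vectors stable under a derivation contains a nonzero vector of constants. -/
theorem Derivation.exists_constant_mem {k κ ι : Type*} [CommRing k] [Field κ] [Algebra k κ]
    [Finite ι] (D : Derivation k κ κ) (W : Submodule κ (ι → κ)) (hW : W ≠ ⊥)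
    (hD : ∀ f ∈ W, (fun i => D (f i)) ∈ W) :
    ∃ f ∈ W, f ≠ 0 ∧ ∀ i, D (f i) = 0 := by
  have hne : {f : ι → κ | f ∈ W ∧ f ≠ 0}.Nonempty := W.ne_bot_iff.mp hW
  obtain ⟨f, ⟨hf, hf0⟩, hmin⟩ := exists_minimalFor_of_wellFoundedLT
    (fun f : ι → κ => f ∈ W ∧ f ≠ 0) (fun f => (Function.support f).ncard) hne
  obtain ⟨i₀, hi₀⟩ := Function.ne_iff.mp hf0
  rw [Pi.zero_apply] at hi₀
  refine ⟨(f i₀)⁻¹ • f, W.smul_mem _ hf, smul_ne_zero (inv_ne_zero hi₀) hf0, ?_⟩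
  by_contra hcon
  have hg : ((fun i => D (((f i₀)⁻¹ • f) i)) : ι → κ) ≠ 0 := fun h =>
    hcon fun i => congrFun h i
  have hlt : (Function.support fun i => D (((f i₀)⁻¹ • f) i)).ncard <
      (Function.support f).ncard := by
    refine Set.ncard_lt_ncard ⟨fun i hi hfi => hi ?_, fun hle => ?_⟩ (Set.toFinite _)
    · have hfi : f i = 0 := hfi
      simp [hfi]
    · refine hle (a := i₀) hi₀ ?_
      simp [hi₀]
  exact absurd (hmin ⟨hD _ (W.smul_mem (f i₀)⁻¹ hf), hg⟩ hlt.le) (not_le.mpr hlt)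

/-- The field of constants of a derivation. -/
def Derivation.constants {k κ : Type*} [Field k] [Field κ] [Algebra k κ] (D : Derivation k κ κ) :
    IntermediateField k κ where
  carrier := {x | D x = 0}
  mul_mem' {x y} hx hy := by
    rw [Set.mem_ofPred_eq] at *
    simp [hx, hy]
  add_mem' {x y} hx hy := by
    rw [Set.mem_ofPred_eq] at *
    simp [hx, hy]
  algebraMap_mem' c := D.map_algebraMap c
  inv_mem' x hx := by
    rw [Set.mem_ofPred_eq] at *
    rw [Derivation.leibniz_inv, hx, smul_zero]

/-- The logarithmic differential of a unit as a functional on derivations. -/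
def Derivation.dlogFunctional (k : Type*) {κ : Type*} [CommRing k] [Field κ] [Algebra k κ]
    (x : κˣ) : Derivation k κ κ →ₗ[κ] κ where
  toFun D := D.dlog (Additive.ofMul x)
  map_add' D E := by simp [Derivation.dlog_ofMul, add_div]
  map_smul' c D := by simp [Derivation.dlog_ofMul, mul_div_assoc]

theorem Derivation.dlogFunctional_apply {k κ : Type*} [CommRing k] [Field κ] [Algebra k κ]
    (x : κˣ) (D : Derivation k κ κ) :
    Derivation.dlogFunctional k x D = D.dlog (Additive.ofMul x) := rfl

theorem Derivation.apply_dlog {k κ : Type*} [CommRing k] [Field κ] [Algebra k κ]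
    (x : κˣ) (D E : Derivation k κ κ) :
    D (E.dlog (Additive.ofMul x)) =
      E (D.dlog (Additive.ofMul x)) + ⁅D, E⁆.dlog (Additive.ofMul x) := by
  have hx := x.ne_zero
  simp only [Derivation.dlog_ofMul, Derivation.leibniz_div, Derivation.commutator_apply,
    smul_eq_mul]
  field_simp
  ring

/-- Multiplicative groups of functions whose logarithmic derivatives are regular have finite rank
modulo functions with zero derivative. -/
theorem RelFiniteRank.of_dlog {k κ Γ : Type*} [Field k] [CharZero k] [Field κ] [Algebra k κ]
    [Algebra.EssFiniteType k κ] [CommGroup Γ] (A : Subalgebra k κ) (hA : A.FG)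
    (hfrac : ∀ z : κ, ∃ a ∈ A, ∃ b ∈ A, b ≠ 0 ∧ z = a / b) (D : Derivation k κ κ)
    (z : Γ →* κˣ) (H H' : Subgroup Γ) (hH : ∀ γ ∈ H, D.dlog (Additive.ofMul (z γ)) ∈ A)
    (hH' : ∀ γ, D (z γ : κ) = 0 → γ ∈ H') : RelFiniteRank H H' := by
  obtain ⟨V, hV, hdlog⟩ := Derivation.exists_finiteDimensional_dlog A hA hfrac D
  have _ : Module.Finite κ (Derivation k κ κ) :=
    Module.Finite.equiv (KaehlerDifferential.linearMapEquivDerivation k κ)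
  let r := Module.finrank k V
  let N := Module.finrank κ (Module.Dual κ (Derivation k κ κ)) + 1
  let e : Fin N × Fin (r + 1) ≃ Fin (N * (r + 1)) := finProdFinEquiv
  refine ⟨N * (r + 1), fun v hv => ?_⟩
  have hex : ∀ i : Fin N, ∃ c : Fin (r + 1) → k, c ≠ 0 ∧
      ∑ l, algebraMap k κ (c l) * D.dlog (Additive.ofMul (z (v (e (i, l))))) = 0 := by
    intro i
    let y : Fin (r + 1) → V := fun l => ⟨_, hdlog _ (hH _ (hv (e (i, l))))⟩
    have hy : ¬ LinearIndependent k y := fun hli => by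
      have := hli.fintype_card_le_finrank
      simp [r] at this
    obtain ⟨c, hc, l, hl⟩ := Fintype.not_linearIndependent_iff.mp hy
    refine ⟨c, fun h0 => hl (by rw [h0]; rfl), ?_⟩
    have := congrArg (V.subtype) hc
    simpa [y, Algebra.smul_def] using this
  choose c hc0 hc using hex
  let θ : Fin N → Module.Dual κ (Derivation k κ κ) := fun i =>
    ∑ l, algebraMap k κ (c i l) • Derivation.dlogFunctional k (z (v (e (i, l))))
  have hθ : ∀ i E, θ i E =
      ∑ l, algebraMap k κ (c i l) * E.dlog (Additive.ofMul (z (v (e (i, l))))) := fun i E => by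
    simp [θ, Derivation.dlogFunctional_apply, Algebra.smul_def]
  have hDθ : ∀ i E, D (θ i E) = θ i ⁅D, E⁆ := by
    intro i E
    have h0 := congrArg E (hc i)
    simp only [hθ, map_sum, Derivation.leibniz, Derivation.map_algebraMap, mul_zero,
      add_zero,
      Derivation.apply_dlog _ D E, smul_eq_mul, mul_add, Finset.sum_add_distrib, map_zero] at h0 ⊢
    rw [h0, zero_add]
  let W : Submodule κ (Fin N → κ) := LinearMap.ker (Fintype.linearCombination κ θ)
  have hW : ∀ f, f ∈ W ↔ ∀ E, ∑ i, f i * θ i E = 0 := fun f => by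
    rw [LinearMap.mem_ker, Fintype.linearCombination_apply, LinearMap.ext_iff]
    simp
  have hWne : W ≠ ⊥ := by
    intro hbot
    have hli : LinearIndependent κ θ := Fintype.linearIndependent_iff.mpr fun f hf => by
      have : f ∈ W := by rw [LinearMap.mem_ker, Fintype.linearCombination_apply, hf]
      rw [hbot, Submodule.mem_bot] at this
      simp [this]
    have := hli.fintype_card_le_finrank
    simp [N] at this
  obtain ⟨f, hf, hf0, hDf⟩ := D.exists_constant_mem W hWne fun f hf => (hW _).mpr fun E => by
    have h1 := congrArg D ((hW f).mp hf E)
    have h2 := (hW f).mp hf ⁅D, E⁆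
    simp only [map_sum, Derivation.leibniz, smul_eq_mul, hDθ, Finset.sum_add_distrib, map_zero,
      h2, zero_add] at h1
    rw [← h1]
    exact Finset.sum_congr rfl fun i _ => mul_comm _ _
  let F := D.constants
  have _ : Algebra.EssFiniteType F κ := Algebra.EssFiniteType.of_comp k F κ
  let γ : Fin N × Fin (r + 1) → F := fun p => ⟨f p.1, hDf p.1⟩ * algebraMap k F (c p.1 p.2)
  have hγ0 : γ ≠ 0 := by
    obtain ⟨i, hi⟩ := Function.ne_iff.mp hf0
    obtain ⟨l, hl⟩ := Function.ne_iff.mp (hc0 i)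
    refine Function.ne_iff.mpr ⟨(i, l), mul_ne_zero (fun h => hi (congrArg Subtype.val h)) ?_⟩
    simpa using hl
  obtain ⟨q, hq0, hq⟩ := exists_prod_zpow_isAlgebraic γ hγ0 (fun p => z (v (e p))) fun E => by
    rw [Fintype.sum_prod_type, ← (hW f).mp hf (E.restrictScalars k)]
    refine Finset.sum_congr rfl fun i _ => ?_
    rw [hθ, Finset.mul_sum]
    refine Finset.sum_congr rfl fun l _ => ?_
    rw [← mul_assoc]
    rfl
  refine ⟨fun j => q (e.symm j), fun h0 => hq0 (funext fun p => ?_), hH' _ ?_⟩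
  · simpa using congrFun h0 (e p)
  · have h1 := D.eq_zero_of_isAlgebraic (K := F) (fun x => x.2) hq
    convert! h1 using 3
    rw [map_prod, ← e.prod_comp]
    simp

theorem RelFiniteRank.of_subgroupOf {Γ : Type*} [CommGroup Γ] {H H' : Subgroup Γ}
    (h : RelFiniteRank (⊤ : Subgroup H) (H'.subgroupOf H)) : RelFiniteRank H H' := by
  obtain ⟨n, hn⟩ := h
  refine ⟨n, fun v hv => ?_⟩
  obtain ⟨c, hc, hc'⟩ := hn (fun i => ⟨v i, hv i⟩) fun _ => Subgroup.mem_top _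
  refine ⟨c, hc, ?_⟩
  simpa [Subgroup.mem_subgroupOf] using hc'

/-- The version of `RelFiniteRank.of_dlog` for a derivation along a field embedding. -/
theorem RelFiniteRank.of_derivation {k E κ Γ : Type*} [Field k] [CharZero k] [Field E] [Field κ]
    [Algebra k E] [Algebra k κ] [Algebra.EssFiniteType k κ] [CommGroup Γ]
    (A : Subalgebra k κ) (hA : A.FG) (hfrac : ∀ z : κ, ∃ a ∈ A, ∃ b ∈ A, b ≠ 0 ∧ z = a / b)
    (ι : E →ₐ[k] κ) (D : E →ₗ[k] κ) (hD : ∀ x y, D (x * y) = ι x * D y + ι y * D x)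
    (g : Γ →* Eˣ) (H H' : Subgroup Γ) (hH : ∀ γ ∈ H, D (g γ) / ι (g γ) ∈ A)
    (hH' : ∀ γ, D (g γ : E) = 0 → γ ∈ H') : RelFiniteRank H H' := by
  let _ : Algebra E κ := ι.toRingHom.toAlgebra
  have _ : IsScalarTower k E κ := IsScalarTower.of_algebraMap_eq fun c => (ι.commutes c).symm
  have _ : Algebra.EssFiniteType E κ := Algebra.EssFiniteType.of_comp k E κ
  have _ : CharZero E := charZero_of_injective_algebraMap (algebraMap k E).injective
  obtain ⟨D', hD'⟩ := Derivation.exists_extension (Derivation.mk' D fun x y => hD x y)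
  replace hD' : ∀ x, D' (ι x) = D x := hD'
  refine RelFiniteRank.of_dlog A hA hfrac D' ((Units.map (ι : E →* κ)).comp g) H H'
    (fun γ hγ => ?_) fun γ h => hH' γ ?_
  · rw [Derivation.dlog_ofMul]
    change D' (ι (g γ)) / ι (g γ) ∈ A
    rw [hD']
    exact hH γ hγ
  · rw [← hD']
    exact h

/-- A nonzero ideal of an Artinian local ring surjects onto the residue field. -/
theorem IsLocalRing.exists_surjective_residueField {T : Type*} [CommRing T] [IsLocalRing T]
    [IsArtinianRing T] {I : Ideal T} (hI : I ≠ ⊥) :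
    ∃ φ : I →ₗ[T] IsLocalRing.ResidueField T, Function.Surjective φ := by
  have _ : Nontrivial I := Submodule.nontrivial_iff_ne_bot.2 hI
  obtain ⟨N, hN, -⟩ := (eq_top_or_exists_le_coatom (⊥ : Submodule T I)).resolve_left bot_ne_top
  have hs : IsSimpleModule T (I ⧸ N) := isSimpleModule_iff_isCoatom.2 hN
  obtain ⟨M, hM, ⟨e⟩⟩ := isSimpleModule_iff_quot_maximal.1 hs
  obtain rfl := IsLocalRing.eq_maximalIdeal hM
  exact ⟨e.toLinearMap.comp N.mkQ, e.surjective.comp N.mkQ_surjective⟩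

/-- The elements of `Γ` that a homomorphism to `Tˣ` sends to units congruent to `1` modulo `I`. -/
def Ideal.congrKer {T Γ : Type*} [CommRing T] [CommGroup Γ] (u : Γ →* Tˣ) (I : Ideal T) :
    Subgroup Γ :=
  ((Units.map (Ideal.Quotient.mk I : T →* T ⧸ I)).comp u).ker

theorem Ideal.mem_congrKer {T Γ : Type*} [CommRing T] [CommGroup Γ] {u : Γ →* Tˣ} {I : Ideal T}
    {γ : Γ} : γ ∈ I.congrKer u ↔ (u γ : T) - 1 ∈ I := by
  rw [congrKer, MonoidHom.mem_ker, Units.ext_iff, ← Ideal.Quotient.eq_zero_iff_mem, map_sub,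
    sub_eq_zero]
  rfl

section

variable {k T FR Γ : Type*} [Field k] [CharZero k] [CommRing T] [IsLocalRing T] [Algebra k T]
  [Algebra.EssFiniteType k (IsLocalRing.ResidueField T)] [Field FR] [Algebra k FR] [CommGroup Γ]

theorem RelFiniteRank.congrKer_ker (S₀ : Subalgebra k T) (hS₀ : S₀.FG)
    (hfrac : ∀ t : T, ∃ a ∈ S₀, ∃ b ∈ S₀, IsUnit b ∧ t * b = a) (F₁ F₂ : FR →ₐ[k] T)
    (g : Γ →* FRˣ) (u : Γ →* Tˣ) (hu : ∀ γ, (u γ : T) ∈ S₀)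
    (hg : ∀ γ, F₁ (g γ) = u γ * F₂ (g γ)) {I : Ideal T} (hI : I ≠ ⊤)
    (φ : I →ₗ[T] IsLocalRing.ResidueField T) :
    RelFiniteRank (I.congrKer u) (Ideal.congrKer u ((LinearMap.ker φ).map I.subtype)) := by
  classical
  have hIm := IsLocalRing.le_maximalIdeal hI
  let π : T →ₐ[k] IsLocalRing.ResidueField T := IsScalarTower.toAlgHom k T _
  have hπ : ∀ t (x : I), φ (t • x) = π t * φ x := fun t x => by
    rw [map_smul, Algebra.smul_def]; rfl
  have hπI : ∀ t ∈ I, π t = 0 := fun t ht =>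
    (IsLocalRing.residue_eq_zero_iff t).2 (hIm ht)
  have hNoeth : IsNoetherianRing S₀ := by
    have _ : Algebra.FiniteType k S₀ := S₀.fg_iff_finiteType.1 hS₀
    exact Algebra.FiniteType.isNoetherianRing k S₀
  obtain ⟨s, hs⟩ := (isNoetherianRing_iff_ideal_fg _).1 hNoeth (I.comap S₀.val)
  have hsI : ∀ y ∈ s, (y : T) ∈ I := fun y hy => by
    have : y ∈ I.comap S₀.val := hs ▸ Ideal.subset_span hy
    exact this
  let A : Subalgebra k (IsLocalRing.ResidueField T) := S₀.map π ⊔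
    Algebra.adjoin k ↑(s.attach.image fun y => φ ⟨y.1, hsI y.1 y.2⟩)
  have hA : A.FG := (hS₀.map π).sup (Subalgebra.fg_adjoin_finset _)
  have hSA : ∀ t ∈ S₀, π t ∈ A := fun t ht => (le_sup_left : _ ≤ A) ⟨t, ht, rfl⟩
  have hφA : ∀ y ∈ S₀, ∀ hy : y ∈ I, φ ⟨y, hy⟩ ∈ A := by
    intro y hyS hy
    have hmem : (⟨y, hyS⟩ : S₀) ∈ Ideal.span (s : Set S₀) := by
      rw [hs]; exact hy
    suffices h : ∀ z ∈ Ideal.span (s : Set S₀), ∀ hz : (z : T) ∈ I, φ ⟨z, hz⟩ ∈ A from h _ hmem hy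
    intro z hz
    induction hz using Submodule.span_induction with
    | mem x hx =>
      intro hxI
      refine (le_sup_right : _ ≤ A) (Algebra.subset_adjoin ?_)
      exact Finset.mem_coe.2 (Finset.mem_image.2 ⟨⟨x, hx⟩, Finset.mem_attach _ _, rfl⟩)
    | zero => intro h; convert A.zero_mem; exact map_zero φ
    | add x y hx hy ihx ihy =>
      intro h
      have hmem : ∀ z ∈ Submodule.span S₀ (s : Set S₀), (z : T) ∈ I := fun z hz => by
        have : z ∈ I.comap S₀.val := hs ▸ hz
        exact this
      convert A.add_mem (ihx (hmem x hx)) (ihy (hmem y hy))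
      rw [← map_add]; rfl
    | smul t x hx ih =>
      intro h
      have hmem : (x : T) ∈ I := by
        have : x ∈ I.comap S₀.val := hs ▸ hx
        exact this
      convert A.mul_mem (hSA t t.2) (ih hmem)
      rw [← hπ]; rfl
  let E : IntermediateField k FR := Subalgebra.toIntermediateField
    (AlgHom.equalizer ((Ideal.Quotient.mkₐ k I).comp F₁) ((Ideal.Quotient.mkₐ k I).comp F₂))
    fun x hx => by
      have h : ∀ (F : FR →ₐ[k] T ⧸ I), x ≠ 0 → F x * F x⁻¹ = 1 := fun F h0 => by
        rw [← map_mul, mul_inv_cancel₀ h0, map_one]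
      rcases eq_or_ne x 0 with rfl | h0
      · rw [inv_zero]; exact hx
      · have h1 := h ((Ideal.Quotient.mkₐ k I).comp F₁) h0
        have h2 := h ((Ideal.Quotient.mkₐ k I).comp F₂) h0
        rw [AlgHom.mem_equalizer] at hx ⊢
        rw [← hx] at h2
        exact left_inv_eq_right_inv ((mul_comm _ _).trans h1) h2
  have hE : ∀ x : FR, x ∈ E ↔ F₁ x - F₂ x ∈ I := fun x => by
    rw [← Ideal.Quotient.eq_zero_iff_mem, map_sub, sub_eq_zero]
    rfl
  let d : E →ₗ[k] I :=
    { toFun := fun x => ⟨F₁ x - F₂ x, (hE _).1 x.2⟩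
      map_add' := fun x y => by ext; simp; ring
      map_smul' := fun c x => by ext; simp [smul_sub] }
  let ι : E →ₐ[k] IsLocalRing.ResidueField T := (π.comp F₂).comp E.val
  have hι : ∀ x : E, π (F₁ x) = ι x := fun x => by
    have := hπI _ ((hE _).1 x.2)
    rwa [map_sub, sub_eq_zero] at this
  let D : E →ₗ[k] IsLocalRing.ResidueField T := (φ.restrictScalars k).comp d
  have hD : ∀ x y, D (x * y) = ι x * D y + ι y * D x := fun x y => by
    have : d (x * y) = F₁ x • d y + F₂ y • d x := by
      ext; simp [d]; ring
    change φ (d (x * y)) = _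
    rw [this, map_add, hπ, hπ, hι]
    rfl
  have hgE : ∀ γ ∈ I.congrKer u, ((g γ : FRˣ) : FR) ∈ E := fun γ hγ => by
    rw [hE, hg]
    have : (u γ : T) * F₂ (g γ) - F₂ (g γ) = (u γ - 1) * F₂ (g γ) := by ring
    rw [this]
    exact I.mul_mem_right _ (Ideal.mem_congrKer.1 hγ)
  let g' : I.congrKer u →* Eˣ :=
    { toFun := fun γ => Units.mk0 ⟨g γ, hgE γ γ.2⟩ fun h => (g γ).ne_zero (congrArg Subtype.val h)
      map_one' := by ext; simp
      map_mul' := fun x y => by ext; simp }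
  have hDg : ∀ γ : I.congrKer u,
      D (g' γ) = ι (g' γ) * φ ⟨u γ - 1, Ideal.mem_congrKer.1 γ.2⟩ := fun γ => by
    change φ (d (g' γ)) = π (F₂ (g γ)) * _
    rw [← hπ]
    congr 1
    ext
    change F₁ (g γ) - F₂ (g γ) = F₂ (g γ) * (u γ - 1)
    rw [hg]
    ring
  have hι0 : ∀ γ, ι (g' γ) ≠ 0 := fun γ => by simp
  refine RelFiniteRank.of_subgroupOf (RelFiniteRank.of_derivation A hA (fun z => ?_) ι D hD g' _ _
    (fun γ _ => ?_) fun γ hγ => ?_)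
  · obtain ⟨t, rfl⟩ := IsLocalRing.residue_surjective z
    obtain ⟨a, ha, b, hb, hbu, h⟩ := hfrac t
    have hb0 : π b ≠ 0 := (hbu.map π).ne_zero
    exact ⟨π a, hSA a ha, π b, hSA b hb, hb0, by rw [eq_div_iff hb0, ← h, map_mul]; rfl⟩
  · rw [hDg, mul_div_cancel_left₀ _ (hι0 γ)]
    exact hφA _ (S₀.sub_mem (hu γ) S₀.one_mem) _
  · rw [hDg, mul_eq_zero] at hγ
    rw [Subgroup.mem_subgroupOf, Ideal.mem_congrKer]
    exact ⟨_, hγ.resolve_left (hι0 γ), rfl⟩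

/-- If `u γ` measures the difference of two embeddings of a field into an Artinian local ring, then
finite corank of the kernel of `u` can be checked modulo the maximal ideal. -/
theorem RelFiniteRank.ker_of_maximalIdeal [IsArtinianRing T] (S₀ : Subalgebra k T) (hS₀ : S₀.FG)
    (hfrac : ∀ t : T, ∃ a ∈ S₀, ∃ b ∈ S₀, IsUnit b ∧ t * b = a) (F₁ F₂ : FR →ₐ[k] T)
    (g : Γ →* FRˣ) (u : Γ →* Tˣ) (hu : ∀ γ, (u γ : T) ∈ S₀)
    (hg : ∀ γ, F₁ (g γ) = u γ * F₂ (g γ))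
    (h : RelFiniteRank ⊤ ((IsLocalRing.maximalIdeal T).congrKer u)) : RelFiniteRank ⊤ u.ker := by
  obtain ⟨I, ⟨hI, hrank⟩, hmin⟩ := exists_minimal_of_wellFoundedLT
    (fun I : Ideal T => I ≠ ⊤ ∧ RelFiniteRank ⊤ (I.congrKer u)) ⟨_, Ideal.IsPrime.ne_top', h⟩
  rcases eq_or_ne I ⊥ with rfl | hI0
  · refine hrank.mono fun γ hγ => ?_
    rw [Ideal.mem_congrKer, Ideal.mem_bot, sub_eq_zero] at hγ
    rwa [MonoidHom.mem_ker, Units.ext_iff]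
  · obtain ⟨φ, hφ⟩ := IsLocalRing.exists_surjective_residueField hI0
    have hle : (LinearMap.ker φ).map I.subtype ≤ I := Submodule.map_subtype_le _ _
    have hJ := hmin ⟨fun h => hI (top_le_iff.1 (h ▸ hle)), hrank.trans
      (RelFiniteRank.congrKer_ker S₀ hS₀ hfrac F₁ F₂ g u hu hg hI φ)⟩ hle
    obtain ⟨x, hx⟩ := hφ 1
    obtain ⟨y, hy, hyx⟩ := hJ x.2
    have : y = x := Subtype.ext hyx
    rw [this, SetLike.mem_coe, LinearMap.mem_ker, hx] at hy
    exact absurd hy one_ne_zero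

end

theorem IsFractionRing.exists_algHom {k R FR T : Type*} [CommRing k] [CommRing R] [Algebra k R]
    [CommRing FR] [Algebra R FR] [IsDomain R] [IsFractionRing R FR] [Algebra k FR]
    [IsScalarTower k R FR] [CommRing T] [Algebra k T] (f : R →ₐ[k] T)
    (hf : ∀ r, r ≠ 0 → IsUnit (f r)) :
    ∃ F : FR →ₐ[k] T, ∀ r, F (algebraMap R FR r) = f r :=
  ⟨IsLocalization.liftAlgHom (M := nonZeroDivisors R) (f := f)
    fun y => hf y (nonZeroDivisors.ne_zero y.2), fun r => by
    rw [IsLocalization.liftAlgHom_apply]; exact IsLocalization.lift_eq _ r⟩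

theorem isFracAlgebraic_one_of_isAlgebraic {k D κ : Type*} [Field k] [CommRing D] [Algebra k D]
    [CommRing κ] [Algebra k κ] [Algebra D κ] [IsScalarTower k D κ]
    (hinj : Function.Injective (algebraMap D κ)) {x : D} (hx : IsAlgebraic k (algebraMap D κ x)) :
    IsFracAlgebraic k x 1 := by
  obtain ⟨p, hp, h⟩ := (isAlgebraic_algebraMap_iff hinj).1 hx
  refine ⟨p, hp, ?_⟩
  simpa [Polynomial.aeval_eq_sum_range, Algebra.smul_def] using h

/-- Clearing denominators in `F₁ (g γ) = u γ * F₂ (g γ)`. -/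
def IsQuotientCocycle {k R FR S Γ : Type*} [CommRing k] [CommRing R] [Algebra k R] [Field FR]
    [Algebra R FR] [CommRing S] [Algebra k S] [CommGroup Γ] (f₁ f₂ : R →ₐ[k] S)
    (g : Γ →* FRˣ) (u : Γ →* Sˣ) : Prop :=
  ∀ γ r s, s ≠ 0 → (g γ : FR) * algebraMap R FR s = algebraMap R FR r →
    f₁ r * f₂ s = u γ * (f₂ r * f₁ s)

section

variable {k R FR S Γ : Type*} [Field k] [CommRing R] [Algebra k R] [Field FR]
  [Algebra R FR] [CommRing S] [Algebra k S] [CommGroup Γ] {f₁ f₂ : R →ₐ[k] S}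
  {g : Γ →* FRˣ} {u : Γ →* Sˣ}

theorem IsQuotientCocycle.comp (h : IsQuotientCocycle f₁ f₂ g u) {T : Type*} [CommRing T]
    [Algebra k T] (ψ : S →ₐ[k] T) :
    IsQuotientCocycle (ψ.comp f₁) (ψ.comp f₂) g ((Units.map (ψ : S →* T)).comp u) :=
  fun γ r s hs hr => by
    have := congrArg ψ (h γ r s hs hr)
    simpa using this

variable [IsDomain R] [IsFractionRing R FR]

theorem IsQuotientCocycle.map_eq_mul (h : IsQuotientCocycle f₁ f₂ g u) {T : Type*} [CommRing T]
    (ψ : S →+* T) (F₁ F₂ : FR →+* T) (hF₁ : ∀ r, F₁ (algebraMap R FR r) = ψ (f₁ r))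
    (hF₂ : ∀ r, F₂ (algebraMap R FR r) = ψ (f₂ r)) (γ : Γ) :
    F₁ (g γ) = ψ (u γ) * F₂ (g γ) := by
  obtain ⟨r, s, hs, hrs⟩ := IsFractionRing.div_surjective (A := R) (g γ : FR)
  have hs0 : algebraMap R FR s ≠ 0 := IsFractionRing.to_map_ne_zero_of_mem_nonZeroDivisors hs
  have hr : (g γ : FR) * algebraMap R FR s = algebraMap R FR r := by
    rw [← hrs, div_mul_cancel₀ _ hs0]
  have h1 := congrArg ψ (h γ r s (nonZeroDivisors.ne_zero hs) hr)
  simp only [map_mul, ← hF₁, ← hF₂] at h1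
  rw [← hr, map_mul, map_mul] at h1
  have hu₁ := (IsUnit.mk0 _ hs0).map F₁
  have hu₂ := (IsUnit.mk0 _ hs0).map F₂
  refine (hu₁.mul hu₂).mul_right_cancel ?_
  linear_combination h1

variable [Algebra k FR] [IsScalarTower k R FR]

theorem RelFiniteRank.congrKer_of_prime [CharZero k] [Algebra.FiniteType k S]
    (h : IsQuotientCocycle f₁ f₂ g u) (P : Ideal S) [P.IsPrime]
    (hP : ∀ a b : S ⧸ P, b ≠ 0 → IsFracAlgebraic k a b → ∃ c : k, a = algebraMap k (S ⧸ P) c * b)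
    (hf₁ : ∀ r, r ≠ 0 → f₁ r ∉ P) (hf₂ : ∀ r, r ≠ 0 → f₂ r ∉ P) :
    RelFiniteRank ⊤ (P.congrKer u) := by
  let κ := FractionRing (S ⧸ P)
  let ψ : S →ₐ[k] κ := (IsScalarTower.toAlgHom k (S ⧸ P) κ).comp (Ideal.Quotient.mkₐ k P)
  have hinj : Function.Injective (algebraMap (S ⧸ P) κ) := IsFractionRing.injective _ _
  have hψ0 : ∀ s, ψ s = 0 ↔ s ∈ P := fun s => by
    rw [← Ideal.Quotient.eq_zero_iff_mem, ← map_eq_zero_iff _ hinj]; rfl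
  have hunit : ∀ f : R →ₐ[k] S, (∀ r, r ≠ 0 → f r ∉ P) → ∀ r, r ≠ 0 → IsUnit (ψ.comp f r) :=
    fun f hf r hr => IsUnit.mk0 _ fun h0 => hf r hr ((hψ0 _).1 h0)
  obtain ⟨F₁, hF₁⟩ := IsFractionRing.exists_algHom (FR := FR) (ψ.comp f₁) (hunit f₁ hf₁)
  obtain ⟨F₂, hF₂⟩ := IsFractionRing.exists_algHom (FR := FR) (ψ.comp f₂) (hunit f₂ hf₂)
  have hg : ∀ γ, F₁ (g γ) = ψ (u γ) * F₂ (g γ) :=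
    h.map_eq_mul (ψ : S →+* κ) (F₁ : FR →+* κ) F₂ hF₁ hF₂
  have _ : Algebra.EssFiniteType (S ⧸ P) κ := .of_isLocalization _ (nonZeroDivisors (S ⧸ P))
  have _ : Algebra.EssFiniteType k κ := .comp k (S ⧸ P) κ
  let u' : Γ →* κˣ := (Units.map (ψ : S →* κ)).comp u
  have hA : ψ.range.FG := by
    rw [← Algebra.map_top]; exact (Algebra.FiniteType.out (R := k) (A := S)).map ψ
  have h1 : RelFiniteRank ⊤ ((Units.map (algebraMap k κ : k →* κ)).range.comap u') := by
    refine RelFiniteRank.of_units ψ.range hA (fun z => ?_) u' _ _ (fun γ _ => ⟨_, rfl⟩)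
      fun γ _ hγ => ?_
    · obtain ⟨x, y, hy, rfl⟩ := IsFractionRing.div_surjective (A := S ⧸ P) z
      obtain ⟨a, rfl⟩ := Ideal.Quotient.mk_surjective x
      obtain ⟨b, rfl⟩ := Ideal.Quotient.mk_surjective y
      exact ⟨ψ a, ⟨a, rfl⟩, ψ b, ⟨b, rfl⟩,
        IsFractionRing.to_map_ne_zero_of_mem_nonZeroDivisors (R := S ⧸ P) hy, rfl⟩
    · obtain ⟨c, hc⟩ := hP _ 1 one_ne_zero (isFracAlgebraic_one_of_isAlgebraic hinj hγ)
      have hc' : ((u' γ : κˣ) : κ) = algebraMap k κ c := by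
        rw [mul_one] at hc
        exact (congrArg (algebraMap (S ⧸ P) κ) hc).trans
          (IsScalarTower.algebraMap_apply k (S ⧸ P) κ c).symm
      have hc0 : c ≠ 0 := fun h0 => (u' γ).ne_zero (by rw [hc', h0, map_zero])
      exact ⟨Units.mk0 c hc0, Units.ext hc'.symm⟩
  have hn : ∀ x : Fin ((Algebra.trdeg k κ).toNat + 1) → κ, ¬ AlgebraicIndependent k x := by
    intro x hx
    have hle := hx.lift_cardinalMk_le_trdeg
    rw [← Cardinal.cast_toNat_of_lt_aleph0 (_root_.trdeg_lt_aleph0 k κ)] at hle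
    simp at hle
  refine h1.trans (RelFiniteRank.of_eq_mul_scalar hn F₁ F₂ g _ _ (fun γ hγ => ?_) fun γ hγ => ?_)
  · obtain ⟨c, hc⟩ := hγ
    refine ⟨c, ?_⟩
    rw [hg]
    exact congrArg (· * _) (congrArg Units.val hc).symm
  · rw [Ideal.mem_congrKer, ← hψ0, map_sub, map_one, sub_eq_zero]
    rw [hg] at hγ
    exact (mul_eq_right₀ (by simp)).1 hγ

theorem RelFiniteRank.ker_of_nilradical [CharZero k] [Algebra.FiniteType k S]
    (h : IsQuotientCocycle f₁ f₂ g u) [(nilradical S).IsPrime]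
    (hreg : (nilradical S).primeCompl ≤ nonZeroDivisors S)
    (hf₁ : ∀ r, r ≠ 0 → f₁ r ∉ nilradical S) (hf₂ : ∀ r, r ≠ 0 → f₂ r ∉ nilradical S)
    (hrank : RelFiniteRank ⊤ ((nilradical S).congrKer u)) : RelFiniteRank ⊤ u.ker := by
  let T := Localization.AtPrime (nilradical S)
  have hmax : (nilradical S).map (algebraMap S T) = IsLocalRing.maximalIdeal T :=
    Localization.AtPrime.map_eq_maximalIdeal
  have hinj : Function.Injective (algebraMap S T) := IsLocalization.injective _ hreg
  have _ : IsNoetherianRing S := Algebra.FiniteType.isNoetherianRing k S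
  have _ : IsNoetherianRing T := IsLocalization.isNoetherianRing (nilradical S).primeCompl T ‹_›
  have _ : IsArtinianRing T := by
    rw [isArtinianRing_iff_isNilpotent_maximalIdeal, ← hmax]
    exact (IsNoetherianRing.isNilpotent_nilradical S).map (Ideal.mapHom (algebraMap S T))
  have _ : Algebra.EssFiniteType k (IsLocalRing.ResidueField T) :=
    .of_surjective (IsScalarTower.toAlgHom k T _) IsLocalRing.residue_surjective
  let ψ : S →ₐ[k] T := IsScalarTower.toAlgHom k S T
  have hψ : ∀ s, s ∉ nilradical S → IsUnit (ψ s) := fun s hs =>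
    IsLocalization.map_units T (⟨s, hs⟩ : (nilradical S).primeCompl)
  obtain ⟨F₁, hF₁⟩ := IsFractionRing.exists_algHom (FR := FR) (ψ.comp f₁)
    fun r hr => hψ _ (hf₁ r hr)
  obtain ⟨F₂, hF₂⟩ := IsFractionRing.exists_algHom (FR := FR) (ψ.comp f₂)
    fun r hr => hψ _ (hf₂ r hr)
  have hg : ∀ γ, F₁ (g γ) = ψ (u γ) * F₂ (g γ) :=
    h.map_eq_mul (ψ : S →+* T) (F₁ : FR →+* T) F₂ hF₁ hF₂
  have hA : ψ.range.FG := by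
    rw [← Algebra.map_top]; exact (Algebra.FiniteType.out (R := k) (A := S)).map ψ
  refine (RelFiniteRank.ker_of_maximalIdeal ψ.range hA (fun t => ?_) F₁ F₂ g
    ((Units.map (ψ : S →* T)).comp u) (fun γ => ⟨_, rfl⟩) hg (hrank.mono fun γ hγ => ?_)).mono
    fun γ hγ => ?_
  · obtain ⟨⟨a, b⟩, hab⟩ := IsLocalization.surj (nilradical S).primeCompl t
    exact ⟨ψ a, ⟨a, rfl⟩, ψ b, ⟨b, rfl⟩, hψ _ b.2, hab⟩
  · rw [Ideal.mem_congrKer] at hγ ⊢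
    rw [← hmax]
    have := Ideal.mem_map_of_mem (algebraMap S T) hγ
    rwa [map_sub, map_one] at this
  · rw [MonoidHom.mem_ker, Units.ext_iff] at hγ ⊢
    exact hinj (hγ.trans (map_one _).symm)

theorem RelFiniteRank.congrKer_of_isPrimary [CharZero k] [Algebra.FiniteType k S]
    (h : IsQuotientCocycle f₁ f₂ g u) {q : Ideal S} (hq : q.IsPrimary)
    (hf₁ : ∀ r, r ≠ 0 → f₁ r ∉ q.radical) (hf₂ : ∀ r, r ≠ 0 → f₂ r ∉ q.radical)
    (hrank : RelFiniteRank ⊤ (q.radical.congrKer u)) : RelFiniteRank ⊤ (q.congrKer u) := by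
  have hmem : ∀ x : S, Ideal.Quotient.mk q x ∈ nilradical (S ⧸ q) ↔ x ∈ q.radical := fun x => by
    simp only [mem_nilradical, IsNilpotent, ← map_pow, Ideal.Quotient.eq_zero_iff_mem]
    rfl
  have hrad := Ideal.isPrime_radical hq
  have hprime : (nilradical (S ⧸ q)).IsPrime := by
    have _ : Nontrivial (S ⧸ q) := Ideal.Quotient.nontrivial_iff.2 (Ideal.isPrimary_iff.1 hq).1
    refine ⟨fun htop => ?_, fun {x y} hxy => ?_⟩
    · have : (1 : S ⧸ q) ∈ nilradical (S ⧸ q) := htop ▸ Submodule.mem_top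
      exact not_isNilpotent_one this
    · obtain ⟨x, rfl⟩ := Ideal.Quotient.mk_surjective x
      obtain ⟨y, rfl⟩ := Ideal.Quotient.mk_surjective y
      rw [← map_mul, hmem] at hxy
      rw [hmem, hmem]
      exact hrad.mem_or_mem hxy
  have hreg : (nilradical (S ⧸ q)).primeCompl ≤ nonZeroDivisors (S ⧸ q) := by
    intro x hx
    rw [mem_nonZeroDivisors_iff_right]
    intro y hy
    obtain ⟨x, rfl⟩ := Ideal.Quotient.mk_surjective x
    obtain ⟨y, rfl⟩ := Ideal.Quotient.mk_surjective y
    rw [← map_mul, Ideal.Quotient.eq_zero_iff_mem] at hy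
    rw [Ideal.Quotient.eq_zero_iff_mem]
    exact ((Ideal.isPrimary_iff.1 hq).2 hy).resolve_right fun h => hx ((hmem x).2 h)
  refine RelFiniteRank.ker_of_nilradical (h.comp (Ideal.Quotient.mkₐ k q)) hreg
    (fun r hr h => hf₁ r hr ((hmem _).1 h)) (fun r hr h => hf₂ r hr ((hmem _).1 h))
    (hrank.mono fun γ hγ => ?_)
  rw [Ideal.mem_congrKer] at hγ ⊢
  have := (hmem _).2 hγ
  rwa [map_sub, map_one] at this

/-- Regular elements avoid the primes associated to a minimal primary decomposition of zero. -/
theorem Submodule.IsMinimalPrimaryDecomposition.notMem_radical {S : Type*} [CommRing S]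
    {t : Finset (Ideal S)}
    (ht : Submodule.IsMinimalPrimaryDecomposition (⊥ : Ideal S) t) {q : Ideal S} (hq : q ∈ t)
    {x : S} (hx : x ∈ nonZeroDivisors S) : x ∉ q.radical := by
  classical
  rintro ⟨n, hn⟩
  obtain ⟨y, hy, hyq⟩ := SetLike.not_le_iff_exists.1 (ht.minimal hq)
  replace hy : y ∈ (t.erase q).inf id := by convert hy
  have : y * x ^ n ∈ (⊥ : Ideal S) := by
    rw [← ht.inf_eq, ← Finset.insert_erase hq, Finset.inf_insert]
    exact ⟨q.mul_mem_left _ hn, Ideal.mul_mem_right _ _ hy⟩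
  have hy0 := (mem_nonZeroDivisors_iff_right.1 (pow_mem hx n)) y this
  exact hyq (hy0 ▸ q.zero_mem)

theorem RelFiniteRank.ker_of_isQuotientCocycle [CharZero k] [Algebra.FiniteType k S]
    (h : IsQuotientCocycle f₁ f₂ g u)
    (hS : ∀ P ∈ minimalPrimes S, ∀ a b : S ⧸ P, b ≠ 0 → IsFracAlgebraic k a b →
      ∃ c : k, a = algebraMap k (S ⧸ P) c * b)
    (hf₁ : ∀ r, r ≠ 0 → f₁ r ∈ nonZeroDivisors S) (hf₂ : ∀ r, r ≠ 0 → f₂ r ∈ nonZeroDivisors S) :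
    RelFiniteRank ⊤ u.ker := by
  classical
  have _ : IsNoetherianRing S := Algebra.FiniteType.isNoetherianRing k S
  obtain ⟨t, ht⟩ := Submodule.IsLasker.exists_isMinimalPrimaryDecomposition
    (Submodule.isLasker S S) (⊥ : Ideal S)
  have hq : ∀ q ∈ t, RelFiniteRank ⊤ (Ideal.congrKer u q) := fun q hq => by
    have hrad := Ideal.isPrime_radical (ht.primary hq)
    obtain ⟨P, hP, hPq⟩ := Ideal.exists_minimalPrimes_le (bot_le (a := Ideal.radical q))
    have _ : P.IsPrime := hP.1.1
    refine RelFiniteRank.congrKer_of_isPrimary h (ht.primary hq)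
      (fun r hr => ht.notMem_radical hq (hf₁ r hr)) (fun r hr => ht.notMem_radical hq (hf₂ r hr))
      ((RelFiniteRank.congrKer_of_prime h P (hS P hP)
        (fun r hr hrP => ht.notMem_radical hq (hf₁ r hr) (hPq hrP))
        fun r hr hrP => ht.notMem_radical hq (hf₂ r hr) (hPq hrP)).mono fun γ hγ => ?_)
    rw [Ideal.mem_congrKer] at hγ ⊢
    exact hPq hγ
  refine (RelFiniteRank.finset_inf t (Ideal.congrKer u) hq).mono fun γ hγ => ?_
  have hγ' : ∀ q ∈ t, (u γ : S) - 1 ∈ q := fun q hq =>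
    Ideal.mem_congrKer.1 ((Finset.inf_le hq : _ ≤ Ideal.congrKer u q) hγ)
  have h0 : (u γ : S) - 1 ∈ (⊥ : Ideal S) := by
    rw [← ht.inf_eq, Submodule.mem_finsetInf]
    exact hγ'
  rw [MonoidHom.mem_ker, Units.ext_iff]
  exact sub_eq_zero.1 h0

end

theorem exists_zpow_hom {X : Type*} [CommGroup X] (x : ℕ → X) :
    ∃ φ : Multiplicative (ℕ →₀ ℤ) →* X, ∀ n : ℕ →₀ ℤ,
      φ (Multiplicative.ofAdd n) = ∏ j ∈ n.support, x j ^ n j :=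
  ⟨AddMonoidHom.toMultiplicativeLeft (Finsupp.liftAddHom fun j =>
    (zmultiplesHom (Additive X) (Additive.ofMul (x j)))), fun n => by
    simp [Finsupp.sum, toMul_sum]⟩

theorem exists_units_mul_eq_of_span_eq {S : Type*} [CommRing S] {x y : S}
    (hy : y ∈ nonZeroDivisors S) (h : Ideal.span {x} = Ideal.span {y}) :
    ∃ u : Sˣ, x = u * y := by
  obtain ⟨v, rfl⟩ := Ideal.mem_span_singleton'.1 (h ▸ Ideal.mem_span_singleton_self x)
  obtain ⟨w, hw⟩ := Ideal.mem_span_singleton'.1 (h ▸ Ideal.mem_span_singleton_self y)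
  have hwv : w * v = 1 := by
    have := mem_nonZeroDivisors_iff_right.1 hy (w * v - 1) (by linear_combination hw)
    exact sub_eq_zero.1 this
  exact ⟨⟨v, w, (mul_comm _ _).trans hwv, hwv⟩, rfl⟩

/-- **Theorem 3.1.** If there is a sequence `(a_j)` of nonzero elements of `R`,
multiplicatively independent modulo `kˣ`, with `f₁(a_j)·S = f₂(a_j)·S` for all `j`, then
there is `g ∈ Frac(R) \ k` with `F₁(g) = F₂(g)`; in fact the subgroup `G ≤ Frac(R)ˣ`
generated by the `a_j` meets the subfield `F = {g | F₁ g = F₂ g}` nontrivially. -/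
theorem main_algebra
    (k : Type*) [Field k] [CharZero k]
    (hk : (⊤ : IntermediateField ℚ k).FG)
    (R : Type*) [CommRing R] [IsDomain R] [Algebra k R] [Algebra.FiniteType k R]
    (FR : Type*) [Field FR] [Algebra R FR] [IsFractionRing R FR]
    [Algebra k FR] [IsScalarTower k R FR]
    -- `k` is relatively algebraically closed in `Frac(R)`
    (hRrac : ∀ x : FR, IsAlgebraic k x → ∃ c : k, x = algebraMap k FR c)
    (S : Type*) [CommRing S] [Algebra k S] [Algebra.FiniteType k S]
    -- `k` is relatively algebraically closed in `Frac(S/P)` for each minimal prime `P` of `S`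
    (hSrac : ∀ P ∈ minimalPrimes S, ∀ a b : S ⧸ P, b ≠ 0 → IsFracAlgebraic k a b →
      ∃ c : k, a = algebraMap k (S ⧸ P) c * b)
    (f₁ f₂ : R →ₐ[k] S)
    -- `f₁, f₂` take nonzero elements of `R` to regular elements of `S`
    (hreg₁ : ∀ r : R, r ≠ 0 → f₁ r ∈ nonZeroDivisors S)
    (hreg₂ : ∀ r : R, r ≠ 0 → f₂ r ∈ nonZeroDivisors S)
    -- `FS` is the total ring of fractions of `S`, and `F₁, F₂` the induced embeddings
    (FS : Type*) [CommRing FS] [Algebra S FS] [IsLocalization (nonZeroDivisors S) FS]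
    (F₁ F₂ : FR →+* FS)
    (hF₁ : F₁.comp (algebraMap R FR) = (algebraMap S FS).comp (f₁ : R →+* S))
    (hF₂ : F₂.comp (algebraMap R FR) = (algebraMap S FS).comp (f₂ : R →+* S))
    (a : ℕ → R) (ha0 : ∀ j, a j ≠ 0)
    -- `(a_j)` is multiplicatively independent modulo `kˣ`
    (hmi : ∀ n : ℕ →₀ ℤ,
      (∏ j ∈ n.support, algebraMap R FR (a j) ^ n j) ∈ (algebraMap k FR).range → n = 0)
    -- `f₁(a_j)·S = f₂(a_j)·S` for all `j`
    (hprinc : ∀ j, Ideal.span {f₁ (a j)} = Ideal.span {f₂ (a j)}) :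
    (∃ g : FR, (¬ ∃ c : k, g = algebraMap k FR c) ∧ F₁ g = F₂ g) ∧
    (∃ g : FR, g ≠ 1 ∧ (∃ n : ℕ →₀ ℤ, g = ∏ j ∈ n.support, algebraMap R FR (a j) ^ n j) ∧
      F₁ g = F₂ g) := by
  suffices h : ∃ n : ℕ →₀ ℤ, n ≠ 0 ∧ F₁ (∏ j ∈ n.support, algebraMap R FR (a j) ^ n j) =
      F₂ (∏ j ∈ n.support, algebraMap R FR (a j) ^ n j) by
    obtain ⟨n, hn, h⟩ := h
    exact ⟨⟨_, fun ⟨c, hc⟩ => hn (hmi n ⟨c, hc.symm⟩), h⟩,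
      ⟨_, fun h1 => hn (hmi n ⟨1, (map_one _).trans h1.symm⟩), ⟨n, rfl⟩, h⟩⟩
  replace hF₁ : ∀ r, F₁ (algebraMap R FR r) = algebraMap S FS (f₁ r) := RingHom.congr_fun hF₁
  replace hF₂ : ∀ r, F₂ (algebraMap R FR r) = algebraMap S FS (f₂ r) := RingHom.congr_fun hF₂
  have hinj : Function.Injective (algebraMap S FS) := IsLocalization.injective FS le_rfl
  have ha : ∀ j, algebraMap R FR (a j) ≠ 0 := fun j =>
    (map_ne_zero_iff _ (IsFractionRing.injective R FR)).2 (ha0 j)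
  choose w hw using fun j => exists_units_mul_eq_of_span_eq (hreg₂ _ (ha0 j)) (hprinc j)
  obtain ⟨g, hg⟩ := exists_zpow_hom fun j => Units.mk0 _ (ha j)
  obtain ⟨u, hu⟩ := exists_zpow_hom w
  let G₁ : FRˣ →* FSˣ := Units.map (F₁ : FR →* FS)
  let G₂ : FRˣ →* FSˣ := Units.map (F₂ : FR →* FS)
  let U : Sˣ →* FSˣ := Units.map (algebraMap S FS : S →* FS)
  have hbase : ∀ j, G₁ (Units.mk0 _ (ha j)) = U (w j) * G₂ (Units.mk0 _ (ha j)) := fun j => by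
    ext
    change F₁ (algebraMap R FR (a j)) = algebraMap S FS (w j) * F₂ (algebraMap R FR (a j))
    rw [hF₁, hF₂, ← map_mul, ← hw]
  have hGU : ∀ γ, G₁ (g γ) = U (u γ) * G₂ (g γ) := fun γ => by
    obtain ⟨n, rfl⟩ := Multiplicative.ofAdd.surjective γ
    simp only [hg, hu, map_prod, map_zpow, hbase, mul_zpow, Finset.prod_mul_distrib]
  replace hGU : ∀ γ, F₁ (g γ) = algebraMap S FS (u γ) * F₂ (g γ) := fun γ =>
    congrArg Units.val (hGU γ)
  have hcocycle : IsQuotientCocycle f₁ f₂ g u := fun γ r s _ hr => hinj <| by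
    simp only [map_mul, ← hF₁, ← hF₂, ← hr, hGU]
    ring
  obtain ⟨m, hm⟩ := RelFiniteRank.ker_of_isQuotientCocycle hcocycle hSrac hreg₁ hreg₂
  obtain ⟨c, hc, hker⟩ := hm (fun i => Multiplicative.ofAdd (Finsupp.single (i : ℕ) 1))
    fun _ => Subgroup.mem_top _
  have hn : ∏ i : Fin m, Multiplicative.ofAdd (Finsupp.single (i : ℕ) (1 : ℤ)) ^ c i =
      Multiplicative.ofAdd (∑ i : Fin m, Finsupp.single (i : ℕ) (c i)) := by
    rw [ofAdd_sum]
    refine Finset.prod_congr rfl fun i _ => ?_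
    rw [← ofAdd_zsmul, Finsupp.smul_single, smul_eq_mul, mul_one]
  rw [hn] at hker
  refine ⟨∑ i : Fin m, Finsupp.single (i : ℕ) (c i), fun h0 => hc ?_, ?_⟩
  · funext i
    have := DFunLike.congr_fun h0 (i : ℕ)
    simpa [Finsupp.finsetSum_apply, Finsupp.single_apply, Fin.val_inj] using this
  · have h1 := hGU (Multiplicative.ofAdd (∑ i : Fin m, Finsupp.single (i : ℕ) (c i)))
    rw [MonoidHom.mem_ker.1 hker, Units.val_one, map_one, one_mul, hg] at h1
    simpa using h1
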